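/- arXiv:1905.11162 — 2 statements merged into one kernel-verified Lean document; each statement's English description precedes it below -/
import Mathlib

section
/- Let ω, W, e be as above with W satisfying (H2), and let Σ = {constant maps equal to z with W(z) = 0} ⊂ L²(ω,ℝ^N). Then for every ε > 0, k_ε := inf { e(v) : v ∈ L²(ω,ℝ^N), dist_{L²}(v, Σ) ≥ ε } > 0. -/
open MeasureTheory Metric Set Filter Topology
open scoped ENNReal NNReal RealInnerProductSpace

/-- `ω ⊂ ℝ^m` has Lipschitz boundary: near each boundary point, in a suitable orthonormal
splitting of `ℝ^m` into a unit direction `u` and its orthogonal complement, `ω` is the open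
hypograph/epigraph of a Lipschitz function. -/
def LipschitzBoundary {m : ℕ} (ω : Set (EuclideanSpace ℝ (Fin m))) : Prop :=
  ∀ p ∈ frontier ω, ∃ u : EuclideanSpace ℝ (Fin m), ‖u‖ = 1 ∧
    ∃ (φ : EuclideanSpace ℝ (Fin m) → ℝ) (K : ℝ≥0) (r : ℝ), 0 < r ∧ LipschitzWith K φ ∧
      ∀ x ∈ Metric.ball p r, (x ∈ ω ↔ φ (x - ⟪x, u⟫ • u) < ⟪x, u⟫)

/-- Membership in `H¹(ω, ℝ^N)` (encoded for an everywhere-defined representative via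
differentiability on `ω` together with integrability of the map and of `|∇v|²`). -/
def MemH1 {m N : ℕ} (ω : Set (EuclideanSpace ℝ (Fin m)))
    (v : EuclideanSpace ℝ (Fin m) → EuclideanSpace ℝ (Fin N)) : Prop :=
  DifferentiableOn ℝ v ω ∧ MeasureTheory.IntegrableOn v ω ∧
    (∫⁻ x in ω, (‖fderivWithin ℝ v ω x‖₊ : ℝ≥0∞) ^ 2) < ⊤

/-- The averaged energy `e(v) = ⨍_ω (|∇v|² + W(v))`. -/
noncomputable def eAvg {m N : ℕ} (W : EuclideanSpace ℝ (Fin N) → ℝ≥0∞)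
    (ω : Set (EuclideanSpace ℝ (Fin m)))
    (v : EuclideanSpace ℝ (Fin m) → EuclideanSpace ℝ (Fin N)) : ℝ≥0∞ :=
  (volume ω)⁻¹ * ∫⁻ x in ω, ((‖fderivWithin ℝ v ω x‖₊ : ℝ≥0∞) ^ 2 + W (v x))

/-- The averaged potential
`V(z) = inf { ⨍_ω (|∇v|² + W(v)) : v ∈ H¹(ω,ℝ^N), ⨍_ω v = z }`. -/
noncomputable def Vavg {m N : ℕ} (W : EuclideanSpace ℝ (Fin N) → ℝ≥0∞)
    (ω : Set (EuclideanSpace ℝ (Fin m))) (z : EuclideanSpace ℝ (Fin N)) : ℝ≥0∞ :=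
  ⨅ v ∈ {v : EuclideanSpace ℝ (Fin m) → EuclideanSpace ℝ (Fin N) |
      MemH1 ω v ∧ (⨍ x in ω, v x) = z}, eAvg W ω v

open scoped Classical in
/-- The energy `e` extended to `L²(ω, ℝ^N)` by `+∞` outside `H¹(ω, ℝ^N)`. -/
noncomputable def eExt {m N : ℕ} (W : EuclideanSpace ℝ (Fin N) → ℝ≥0∞)
    (ω : Set (EuclideanSpace ℝ (Fin m)))
    (v : EuclideanSpace ℝ (Fin m) → EuclideanSpace ℝ (Fin N)) : ℝ≥0∞ :=
  if MemH1 ω v then eAvg W ω v else ⊤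


namespace PoincareAux

/-- The Dirichlet energy on `ω`. -/
noncomputable def Dir {m N : ℕ} (ω : Set (EuclideanSpace ℝ (Fin m)))
    (v : EuclideanSpace ℝ (Fin m) → EuclideanSpace ℝ (Fin N)) : ℝ≥0∞ :=
  ∫⁻ x in ω, ‖fderiv ℝ v x‖ₑ ^ 2

/-- Two sets are related if the mutual oscillation is controlled by the Dirichlet energy. -/
def Rel {m : ℕ} (N : ℕ) (ω A B : Set (EuclideanSpace ℝ (Fin m))) : Prop :=
  ∃ C : ℝ≥0∞, C ≠ ⊤ ∧ ∀ v : EuclideanSpace ℝ (Fin m) → EuclideanSpace ℝ (Fin N),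
    Measurable v → DifferentiableOn ℝ v ω →
      ∫⁻ x in A, ∫⁻ y in B, ‖v x - v y‖ₑ ^ 2 ≤ C * Dir ω v

lemma sq_add_le (a b : ℝ≥0∞) : (a + b) ^ 2 ≤ 2 * a ^ 2 + 2 * b ^ 2 := by
  rcases eq_or_ne a ⊤ with rfl | ha
  · simp
  rcases eq_or_ne b ⊤ with rfl | hb
  · simp
  lift a to ℝ≥0 using ha
  lift b to ℝ≥0 using hb
  norm_cast
  rw [← NNReal.coe_le_coe]
  push_cast
  nlinarith [sq_nonneg ((a : ℝ) - b)]

lemma tri {N : ℕ} (a b c : EuclideanSpace ℝ (Fin N)) :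
    ‖a - c‖ₑ ^ 2 ≤ 2 * ‖a - b‖ₑ ^ 2 + 2 * ‖b - c‖ₑ ^ 2 := by
  refine le_trans ?_ (sq_add_le _ _)
  have h : ‖a - c‖ₑ ≤ ‖a - b‖ₑ + ‖b - c‖ₑ := by
    rw [← sub_add_sub_cancel a b c]
    exact enorm_add_le (a - b) (b - c)
  gcongr

lemma cs {α : Type*} [MeasurableSpace α] (μ : Measure α) [IsProbabilityMeasure μ]
    (g : α → ℝ≥0∞) (hg : AEMeasurable g μ) : (∫⁻ x, g x ∂μ) ^ 2 ≤ ∫⁻ x, g x ^ 2 ∂μ := by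
  have h := ENNReal.lintegral_mul_le_Lp_mul_Lq μ
    (Real.HolderConjugate.two_two) hg (aemeasurable_const (b := (1 : ℝ≥0∞)))
  simp only [Pi.mul_apply, mul_one, ENNReal.one_rpow, lintegral_const, measure_univ] at h
  calc _ ≤ _ := pow_le_pow_left' h 2
    _ = _ := by
      rw [← ENNReal.rpow_natCast, ← ENNReal.rpow_mul]
      norm_num

variable {m N : ℕ} {ω : Set (EuclideanSpace ℝ (Fin m))}

lemma line_bound (hω : IsOpen ω) {v : EuclideanSpace ℝ (Fin m) → EuclideanSpace ℝ (Fin N)}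
    (hv : DifferentiableOn ℝ v ω) (x w : EuclideanSpace ℝ (Fin m))
    (h : ∀ s ∈ Icc (0 : ℝ) 1, x + s • w ∈ ω) :
    ‖v (x + w) - v x‖ₑ ^ 2 ≤
      ‖w‖ₑ ^ 2 * ∫⁻ s in Ioc (0 : ℝ) 1, ‖fderiv ℝ v (x + s • w)‖ₑ ^ 2 := by
  rcases eq_or_ne w 0 with rfl | hw
  · simp
  have hw' : ‖w‖ₑ ^ 2 ≠ 0 := by simpa using hw
  rcases eq_or_ne (∫⁻ s in Ioc (0 : ℝ) 1, ‖fderiv ℝ v (x + s • w)‖ₑ ^ 2) ⊤ with hT | hT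
  · rw [hT, ENNReal.mul_top hw']; exact le_top
  have : IsProbabilityMeasure (volume.restrict (Ioc (0 : ℝ) 1)) := ⟨by simp⟩
  have hmeas : Measurable (fun s : ℝ => fderiv ℝ v (x + s • w)) :=
    (measurable_fderiv ℝ v).comp (by fun_prop)
  have hmeas' : Measurable (fun s : ℝ => fderiv ℝ v (x + s • w) w) :=
    (measurable_fderiv_apply_const ℝ v w).comp (by fun_prop)
  have hbd : ∫⁻ s in Ioc (0 : ℝ) 1, ‖fderiv ℝ v (x + s • w) w‖ₑ ≤
      ‖w‖ₑ * ∫⁻ s in Ioc (0 : ℝ) 1, ‖fderiv ℝ v (x + s • w)‖ₑ := by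
    rw [← lintegral_const_mul _ hmeas.enorm]
    refine lintegral_mono fun s => ?_
    rw [mul_comm]
    exact ContinuousLinearMap.le_opENorm _ _
  have hcs := cs (volume.restrict (Ioc (0 : ℝ) 1)) _ hmeas.enorm.aemeasurable
  have hfin : ∫⁻ s in Ioc (0 : ℝ) 1, ‖fderiv ℝ v (x + s • w)‖ₑ ≠ ⊤ := by
    intro h0
    rw [h0] at hcs
    simp at hcs
    exact hT hcs
  have hint : IntervalIntegrable (fun s : ℝ => fderiv ℝ v (x + s • w) w) volume 0 1 := by
    rw [intervalIntegrable_iff_integrableOn_Ioc_of_le zero_le_one]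
    exact ⟨hmeas'.aestronglyMeasurable,
      lt_of_le_of_lt hbd (ENNReal.mul_lt_top enorm_lt_top hfin.lt_top)⟩
  have hftc := intervalIntegral.integral_eq_sub_of_hasDerivAt
    (f := fun s : ℝ => v (x + s • w)) (a := 0) (b := 1) (fun s hs => by
      rw [uIcc_of_le zero_le_one] at hs
      have h1 := ((hv _ (h s hs)).differentiableAt (hω.mem_nhds (h s hs))).hasFDerivAt
      have h2 : HasDerivAt (fun s : ℝ => x + s • w) w s := by
        simpa using ((hasDerivAt_id s).smul_const w).const_add x
      exact h1.comp_hasDerivAt s h2) hint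
  simp only [one_smul, zero_smul, add_zero] at hftc
  rw [← hftc, intervalIntegral.integral_of_le zero_le_one]
  calc _ ≤ (‖w‖ₑ * ∫⁻ s in Ioc (0 : ℝ) 1, ‖fderiv ℝ v (x + s • w)‖ₑ) ^ 2 := by
        gcongr
        exact (enorm_integral_le_lintegral_enorm _).trans hbd
    _ ≤ _ := by
        rw [mul_pow]
        gcongr

lemma transl (hω : IsOpen ω) {v : EuclideanSpace ℝ (Fin m) → EuclideanSpace ℝ (Fin N)}
    (hv : DifferentiableOn ℝ v ω) {A : Set (EuclideanSpace ℝ (Fin m))} (hA : MeasurableSet A)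
    (w : EuclideanSpace ℝ (Fin m))
    (h : ∀ x ∈ A, ∀ s ∈ Icc (0 : ℝ) 1, x + s • w ∈ ω) :
    ∫⁻ x in A, ‖v (x + w) - v x‖ₑ ^ 2 ≤ ‖w‖ₑ ^ 2 * Dir ω v := by
  have hmg : Measurable (fun p : EuclideanSpace ℝ (Fin m) × ℝ =>
      ‖fderiv ℝ v (p.1 + p.2 • w)‖ₑ ^ 2) :=
    (((measurable_fderiv ℝ v).comp (by fun_prop)).enorm).pow_const 2
  calc _ ≤ ∫⁻ x in A, ‖w‖ₑ ^ 2 * ∫⁻ s in Ioc (0 : ℝ) 1, ‖fderiv ℝ v (x + s • w)‖ₑ ^ 2 :=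
        setLIntegral_mono' hA fun x hx => line_bound hω hv x w (h x hx)
    _ = ‖w‖ₑ ^ 2 * ∫⁻ s in Ioc (0 : ℝ) 1, ∫⁻ x in A, ‖fderiv ℝ v (x + s • w)‖ₑ ^ 2 := by
        rw [lintegral_const_mul' _ _ (by simp), lintegral_lintegral_swap]
        exact hmg.aemeasurable
    _ ≤ ‖w‖ₑ ^ 2 * ∫⁻ s in Ioc (0 : ℝ) 1, Dir ω v := by
        refine mul_le_mul_right ?_ _
        refine setLIntegral_mono' (measurableSet_Ioc (a := (0 : ℝ)) (b := 1)) fun s hs => ?_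
        have key : ∀ x, A.indicator (fun x => ‖fderiv ℝ v (x + s • w)‖ₑ ^ 2) x ≤
            (ω.indicator (fun x => ‖fderiv ℝ v x‖ₑ ^ 2)) (x + s • w) := by
          intro x
          by_cases hx : x ∈ A
          · rw [indicator_of_mem hx, indicator_of_mem (h x hx s ⟨hs.1.le, hs.2⟩)]
          · rw [indicator_of_notMem hx]; exact zero_le
        rw [← lintegral_indicator hA, Dir, ← lintegral_indicator hω.measurableSet]
        exact (lintegral_mono key).trans
          (lintegral_add_right_eq_self (μ := volume)
            (ω.indicator (fun x => ‖fderiv ℝ v x‖ₑ ^ 2)) (s • w)).le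
    _ = _ := by simp

lemma Rel.mono {A B A' B' : Set (EuclideanSpace ℝ (Fin m))} (h : Rel N ω A B) (hA : A' ⊆ A)
    (hB : B' ⊆ B) : Rel N ω A' B' := by
  obtain ⟨C, hC, h⟩ := h
  refine ⟨C, hC, fun v hm hd => le_trans ?_ (h v hm hd)⟩
  refine (lintegral_mono_set hA).trans (lintegral_mono fun x => lintegral_mono_set hB)

lemma meas2 {v : EuclideanSpace ℝ (Fin m) → EuclideanSpace ℝ (Fin N)} (hv : Measurable v) :
    Measurable (fun p : EuclideanSpace ℝ (Fin m) × EuclideanSpace ℝ (Fin m) =>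
      ‖v p.1 - v p.2‖ₑ ^ 2) := by
  fun_prop

lemma Rel.symm {A B : Set (EuclideanSpace ℝ (Fin m))} (h : Rel N ω A B) : Rel N ω B A := by
  obtain ⟨C, hC, h⟩ := h
  refine ⟨C, hC, fun v hm hd => le_trans (le_of_eq ?_) (h v hm hd)⟩
  rw [lintegral_lintegral_swap (meas2 hm).aemeasurable]
  have e : ∀ x y, ‖v x - v y‖ₑ ^ 2 = ‖v y - v x‖ₑ ^ 2 := fun x y => by
    rw [← enorm_neg, neg_sub]
  exact lintegral_congr fun x => lintegral_congr fun y => e _ _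

lemma Rel.union {A A' B : Set (EuclideanSpace ℝ (Fin m))} (h : Rel N ω A B)
    (h' : Rel N ω A' B) : Rel N ω (A ∪ A') B := by
  obtain ⟨C, hC, h⟩ := h
  obtain ⟨C', hC', h'⟩ := h'
  refine ⟨C + C', by simp [hC, hC'], fun v hm hd => ?_⟩
  rw [add_mul]
  exact (lintegral_union_le _ _ _).trans (add_le_add (h v hm hd) (h' v hm hd))

lemma Rel.trans {A B C : Set (EuclideanSpace ℝ (Fin m))} (h : Rel N ω A B)
    (h' : Rel N ω B C) (hA : volume A ≠ ⊤) (hB : volume B ≠ 0) (hB' : volume B ≠ ⊤)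
    (hC : volume C ≠ ⊤) :
    Rel N ω A C := by
  obtain ⟨K, hK, h⟩ := h
  obtain ⟨K', hK', h'⟩ := h'
  refine ⟨(volume B)⁻¹ * (2 * volume C * K + 2 * volume A * K'), by finiteness,
    fun v hm hd => ?_⟩
  have m2 := meas2 hm
  have mB : Measurable fun x => ∫⁻ b in B, ‖v x - v b‖ₑ ^ 2 := m2.lintegral_prod_right'
  have mC : Measurable fun b => ∫⁻ c in C, ‖v b - v c‖ₑ ^ 2 := m2.lintegral_prod_right'
  have mAC : Measurable fun x => ∫⁻ c in C, ‖v x - v c‖ₑ ^ 2 := mC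
  have h1 : ∀ x b, ∫⁻ c in C, ‖v x - v c‖ₑ ^ 2 ≤
      2 * volume C * ‖v x - v b‖ₑ ^ 2 + 2 * ∫⁻ c in C, ‖v b - v c‖ₑ ^ 2 := by
    intro x b
    calc _ ≤ ∫⁻ c in C, (2 * ‖v x - v b‖ₑ ^ 2 + 2 * ‖v b - v c‖ₑ ^ 2) :=
          lintegral_mono fun c => tri _ _ _
      _ = _ := by
          rw [lintegral_add_left (by fun_prop), lintegral_const, lintegral_const_mul' _ _ (by simp),
            Measure.restrict_apply_univ]
          ring
  have h2 : ∀ x, volume B * ∫⁻ c in C, ‖v x - v c‖ₑ ^ 2 ≤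
      2 * volume C * (∫⁻ b in B, ‖v x - v b‖ₑ ^ 2) +
        2 * ∫⁻ b in B, ∫⁻ c in C, ‖v b - v c‖ₑ ^ 2 := by
    intro x
    calc _ = ∫⁻ b in B, ∫⁻ c in C, ‖v x - v c‖ₑ ^ 2 := by simp [mul_comm]
      _ ≤ ∫⁻ b in B, (2 * volume C * ‖v x - v b‖ₑ ^ 2 + 2 * ∫⁻ c in C, ‖v b - v c‖ₑ ^ 2) :=
          lintegral_mono fun b => h1 x b
      _ = _ := by
          rw [lintegral_add_left (by fun_prop), lintegral_const_mul' _ _ (by finiteness),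
            lintegral_const_mul' _ _ (by simp)]
  have h3 : volume B * ∫⁻ x in A, ∫⁻ c in C, ‖v x - v c‖ₑ ^ 2 ≤
      2 * volume C * (K * Dir ω v) + 2 * volume A * (K' * Dir ω v) := by
    calc _ = ∫⁻ x in A, volume B * ∫⁻ c in C, ‖v x - v c‖ₑ ^ 2 := by
          rw [lintegral_const_mul' _ _ hB']
      _ ≤ ∫⁻ x in A, (2 * volume C * (∫⁻ b in B, ‖v x - v b‖ₑ ^ 2) +
        2 * ∫⁻ b in B, ∫⁻ c in C, ‖v b - v c‖ₑ ^ 2) := lintegral_mono h2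
      _ = 2 * volume C * (∫⁻ x in A, ∫⁻ b in B, ‖v x - v b‖ₑ ^ 2) +
          2 * volume A * (∫⁻ b in B, ∫⁻ c in C, ‖v b - v c‖ₑ ^ 2) := by
          rw [lintegral_add_left (by fun_prop), lintegral_const_mul' _ _ (by finiteness)]
          simp; ring
      _ ≤ _ := by gcongr; exacts [h v hm hd, h' v hm hd]
  calc _ = (volume B)⁻¹ * (volume B * ∫⁻ x in A, ∫⁻ c in C, ‖v x - v c‖ₑ ^ 2) := by
        rw [← mul_assoc, ENNReal.inv_mul_cancel hB hB', one_mul]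
    _ ≤ (volume B)⁻¹ * (2 * volume C * (K * Dir ω v) + 2 * volume A * (K' * Dir ω v)) := by
        gcongr
    _ = _ := by ring

lemma rel_ball (hω : IsOpen ω) (c : EuclideanSpace ℝ (Fin m)) (ρ : ℝ) (hb : ball c ρ ⊆ ω) :
    Rel N ω (ball c ρ) (ball c ρ) := by
  set B := ball c ρ with hBdef
  have hBm : MeasurableSet B := measurableSet_ball
  have hball : volume (closedBall (0 : EuclideanSpace ℝ (Fin m)) (2 * ρ)) ≠ ⊤ :=
    measure_closedBall_lt_top.ne
  refine ⟨ENNReal.ofReal (2 * ρ) ^ 2 * volume (closedBall (0 : EuclideanSpace ℝ (Fin m)) (2 * ρ)),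
    by finiteness, fun v hm hd => ?_⟩
  have m2 := meas2 hm
  have e1 : ∀ x, ∫⁻ y in B, ‖v x - v y‖ₑ ^ 2 =
      ∫⁻ w, B.indicator (fun y => ‖v x - v y‖ₑ ^ 2) (x + w) := by
    intro x
    rw [← lintegral_indicator hBm]
    exact (lintegral_add_left_eq_self (μ := volume) (B.indicator (fun y => ‖v x - v y‖ₑ ^ 2)) x).symm
  have hmj : Measurable (fun p : EuclideanSpace ℝ (Fin m) × EuclideanSpace ℝ (Fin m) =>
      B.indicator (fun y => ‖v p.1 - v y‖ₑ ^ 2) (p.1 + p.2)) := by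
    have : (fun p : EuclideanSpace ℝ (Fin m) × EuclideanSpace ℝ (Fin m) =>
      B.indicator (fun y => ‖v p.1 - v y‖ₑ ^ 2) (p.1 + p.2)) =
      ((fun p : EuclideanSpace ℝ (Fin m) × EuclideanSpace ℝ (Fin m) => p.1 + p.2) ⁻¹' B).indicator
        (fun p => ‖v p.1 - v (p.1 + p.2)‖ₑ ^ 2) := by
      ext p; rfl
    rw [this]
    exact Measurable.indicator (by fun_prop) (measurable_add hBm)
  simp_rw [e1]
  rw [lintegral_lintegral_swap hmj.aemeasurable]
  calc _ ≤ ∫⁻ w, (closedBall (0 : EuclideanSpace ℝ (Fin m)) (2 * ρ)).indicator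
        (fun _ => ENNReal.ofReal (2 * ρ) ^ 2 * Dir ω v) w := by
        refine lintegral_mono fun w => ?_
        have hAm : MeasurableSet (B ∩ (fun x => x + w) ⁻¹' B) :=
          hBm.inter ((measurable_add_const w) hBm)
        have e2 : ∫⁻ x in B, B.indicator (fun y => ‖v x - v y‖ₑ ^ 2) (x + w) =
            ∫⁻ x in B ∩ (fun x => x + w) ⁻¹' B, ‖v (x + w) - v x‖ₑ ^ 2 := by
          rw [← lintegral_indicator hBm, ← lintegral_indicator hAm]
          congr 1
          ext x
          by_cases hx : x ∈ B <;> by_cases hxw : x + w ∈ B <;>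
            simp [indicator, hx, hxw]
          rw [← enorm_neg, neg_sub]
        simp only [e2]
        by_cases hw : w ∈ closedBall (0 : EuclideanSpace ℝ (Fin m)) (2 * ρ)
        · rw [indicator_of_mem hw]
          refine (transl hω hd hAm w ?_).trans ?_
          · rintro x ⟨hx, hxw⟩ s hs
            apply hb
            exact (convex_ball c ρ).add_smul_mem hx hxw hs
          · gcongr
            rw [← ofReal_norm]
            exact ENNReal.ofReal_le_ofReal (by simpa using hw)
        · have : B ∩ (fun x => x + w) ⁻¹' B = ∅ := by
            ext x
            simp only [mem_inter_iff, mem_preimage, mem_empty_iff_false, iff_false, not_and]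
            intro hx hxw
            apply hw
            rw [mem_closedBall_zero_iff]
            rw [hBdef, mem_ball_iff_norm] at hx hxw
            have : w = (x + w - c) - (x - c) := by abel
            rw [this]
            exact (norm_sub_le _ _).trans (by linarith)
          rw [this]; simp
    _ = _ := by
        rw [lintegral_indicator measurableSet_closedBall]
        simp; ring

/-- Pointwise chain relation. -/
def Q (N : ℕ) (ω : Set (EuclideanSpace ℝ (Fin m))) (x y : EuclideanSpace ℝ (Fin m)) : Prop :=
  ∃ ρ > 0, ball x ρ ⊆ ω ∧ ball y ρ ⊆ ω ∧ Rel N ω (ball x ρ) (ball y ρ)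

lemma Q_all (hω : IsOpen ω) (hc : IsPreconnected ω) {x y : EuclideanSpace ℝ (Fin m)}
    (hx : x ∈ ω) (hy : y ∈ ω) : Q N ω x y := by
  refine hc.induction₂ (Q N ω) ?_ ?_ ?_ hx hy
  · intro x hx
    obtain ⟨ρ, hρ, hb⟩ := Metric.isOpen_iff.1 hω x hx
    refine mem_nhdsWithin_of_mem_nhds ?_
    filter_upwards [ball_mem_nhds x (half_pos hρ)] with y hy
    have hs : ball y (ρ / 2) ⊆ ball x ρ := by
      apply ball_subset_ball'
      rw [mem_ball] at hy; linarith
    have hs' : ball x (ρ / 2) ⊆ ball x ρ := ball_subset_ball (by linarith)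
    exact ⟨ρ / 2, half_pos hρ, hs'.trans hb, hs.trans hb, (rel_ball hω x ρ hb).mono hs' hs⟩
  · rintro x y z - - - ⟨ρ, hρ, hx, hy, h⟩ ⟨ρ', hρ', hy', hz, h'⟩
    have l1 : ∀ x : EuclideanSpace ℝ (Fin m), ball x (min ρ ρ') ⊆ ball x ρ := fun x =>
      ball_subset_ball (min_le_left _ _)
    have l2 : ∀ x : EuclideanSpace ℝ (Fin m), ball x (min ρ ρ') ⊆ ball x ρ' := fun x =>
      ball_subset_ball (min_le_right _ _)
    refine ⟨min ρ ρ', lt_min hρ hρ', (l1 x).trans hx, (l2 z).trans hz, ?_⟩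
    exact (h.mono (l1 x) (l1 y)).trans (h'.mono (l2 y) (l2 z)) measure_ball_lt_top.ne
      (measure_ball_pos _ _ (lt_min hρ hρ')).ne' measure_ball_lt_top.ne measure_ball_lt_top.ne
  · rintro x y - - ⟨ρ, hρ, hx, hy, h⟩
    exact ⟨ρ, hρ, hy, hx, h.symm⟩

lemma Q_extend (hω : IsOpen ω) (hc : IsPreconnected ω) {x y : EuclideanSpace ℝ (Fin m)} {ρ r : ℝ}
    (hρ : 0 < ρ) (hr : 0 < r) (hx : ball x ρ ⊆ ω) (hy : ball y r ⊆ ω) :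
    Rel N ω (ball x ρ) (ball y r) := by
  obtain ⟨s, hs, -, -, h⟩ := Q_all (N := N) hω hc (hx (mem_ball_self hρ)) (hy (mem_ball_self hr))
  have p1 : ∀ x : EuclideanSpace ℝ (Fin m), ∀ t > 0, volume (ball x t) ≠ 0 := fun x t ht =>
    (measure_ball_pos _ _ ht).ne'
  have p2 : ∀ x : EuclideanSpace ℝ (Fin m), ∀ t, volume (ball x t) ≠ ⊤ := fun x t =>
    measure_ball_lt_top.ne
  have h1 : Rel N ω (ball x ρ) (ball x (min s ρ)) := (rel_ball hω x ρ hx).mono subset_rfl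
    (ball_subset_ball (min_le_right _ _))
  have h2 : Rel N ω (ball y (min s r)) (ball y r) := (rel_ball hω y r hy).mono
    (ball_subset_ball (min_le_right _ _)) subset_rfl
  have h3 : Rel N ω (ball x (min s ρ)) (ball y (min s r)) := h.mono
    (ball_subset_ball (min_le_left _ _)) (ball_subset_ball (min_le_left _ _))
  exact (h1.trans h3 (p2 _ _) (p1 _ _ (lt_min hs hρ)) (p2 _ _) (p2 _ _)).trans h2
    (p2 _ _) (p1 _ _ (lt_min hs hr)) (p2 _ _) (p2 _ _)

lemma bdry (hω : IsOpen ω) (hc : IsPreconnected ω) (hl : LipschitzBoundary ω)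
    {x0 : EuclideanSpace ℝ (Fin m)} {r0 : ℝ} (hr0 : 0 < r0) (hb0 : ball x0 r0 ⊆ ω)
    {p : EuclideanSpace ℝ (Fin m)} (hp : p ∈ frontier ω) :
    ∃ ρ > 0, Rel N ω (ω ∩ ball p ρ) (ball x0 r0) := by
  obtain ⟨u, hu, φ, K, r, hr, hφ, H⟩ := hl p hp
  have hK : (0 : ℝ) ≤ K := K.2
  obtain ⟨ρ, hρ, hρr⟩ : ∃ ρ : ℝ, 0 < ρ ∧ (2 * K + 4) * ρ = r :=
    ⟨r / (2 * K + 4), by positivity, by field_simp⟩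
  obtain ⟨τ, hτ⟩ : ∃ τ : ℝ, τ = (2 * K + 2) * ρ := ⟨_, rfl⟩
  have hτ0 : 0 ≤ τ := by rw [hτ]; positivity
  have hτr : τ + ρ < r := by rw [hτ]; linarith
  have huu : ⟪u, u⟫ = (1 : ℝ) := by rw [real_inner_self_eq_norm_sq, hu]; norm_num
  have hin : ∀ d : EuclideanSpace ℝ (Fin m), |⟪d, u⟫| ≤ ‖d‖ := fun d => by
    simpa [hu] using abs_real_inner_le_norm d u
  have hproj : ∀ (x : EuclideanSpace ℝ (Fin m)) (t : ℝ),
      (x + t • u) - ⟪x + t • u, u⟫ • u = x - ⟪x, u⟫ • u := by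
    intro x t
    rw [inner_add_left, real_inner_smul_left, huu, add_smul, mul_one]
    abel
  have hφp : φ (p - ⟪p, u⟫ • u) ≤ ⟪p, u⟫ := by
    by_contra hcon
    push Not at hcon
    have hφc := hφ.continuous
    have hO : IsOpen {x : EuclideanSpace ℝ (Fin m) | ⟪x, u⟫ < φ (x - ⟪x, u⟫ • u)} :=
      isOpen_lt (by fun_prop) (by fun_prop)
    obtain ⟨x, ⟨hx1, hx2⟩, hx3⟩ := mem_closure_iff.1 hp.1 _ (hO.inter isOpen_ball)
      ⟨hcon, mem_ball_self hr⟩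
    have := (H x hx2).1 hx3
    exact absurd hx1 (not_lt.2 this.le)
  have hBω : ball (p + τ • u) ρ ⊆ ω := by
    intro y hy
    obtain ⟨d, rfl⟩ : ∃ d, y = p + d + τ • u := ⟨y - p - τ • u, by abel⟩
    have hd : ‖d‖ < ρ := by
      rw [mem_ball_iff_norm] at hy
      have e : p + d + τ • u - (p + τ • u) = d := by abel
      rwa [e] at hy
    refine (H _ ?_).2 ?_
    · rw [mem_ball_iff_norm]
      have : p + d + τ • u - p = d + τ • u := by abel
      rw [this]
      refine (norm_add_le _ _).trans_lt ?_
      rw [norm_smul, hu, Real.norm_of_nonneg hτ0]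
      linarith
    · rw [hproj]
      have h1 : φ (p + d - ⟪p + d, u⟫ • u) ≤ φ (p - ⟪p, u⟫ • u) + K * (2 * ‖d‖) := by
        have h2 := hφ.dist_le_mul (p + d - ⟪p + d, u⟫ • u) (p - ⟪p, u⟫ • u)
        have h3 : dist (p + d - ⟪p + d, u⟫ • u) (p - ⟪p, u⟫ • u) ≤ 2 * ‖d‖ := by
          rw [dist_eq_norm, inner_add_left, add_smul]
          have : p + d - (⟪p, u⟫ • u + ⟪d, u⟫ • u) - (p - ⟪p, u⟫ • u) = d - ⟪d, u⟫ • u := by abel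
          rw [this]
          refine (norm_sub_le _ _).trans ?_
          rw [norm_smul, hu, mul_one, Real.norm_eq_abs]
          linarith [hin d]
        have h4 := mul_le_mul_of_nonneg_left h3 hK
        rw [Real.dist_eq] at h2
        linarith [le_abs_self (φ (p + d - ⟪p + d, u⟫ • u) - φ (p - ⟪p, u⟫ • u))]
      rw [inner_add_left (p + d), inner_add_left p, real_inner_smul_left, huu, mul_one] at *
      have h5 := neg_le_of_abs_le (hin d)
      have h6 : K * (2 * ‖d‖) ≤ K * (2 * ρ) := by gcongr
      rw [hτ]
      nlinarith
  have hseg : ∀ x ∈ ω ∩ ball p ρ, ∀ s ∈ Icc (0 : ℝ) 1, x + s • (τ • u) ∈ ω := by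
    rintro x ⟨hx, hxp⟩ s hs
    have hsτ : s * τ ≤ τ := by nlinarith [hs.2]
    have hsτ0 : 0 ≤ s * τ := mul_nonneg hs.1 hτ0
    rw [mem_ball_iff_norm] at hxp
    rw [smul_smul]
    refine (H _ ?_).2 ?_
    · rw [mem_ball_iff_norm]
      have : x + (s * τ) • u - p = (x - p) + (s * τ) • u := by abel
      rw [this]
      refine (norm_add_le _ _).trans_lt ?_
      rw [norm_smul, hu, Real.norm_of_nonneg hsτ0]
      linarith
    · rw [hproj, inner_add_left, real_inner_smul_left, huu]
      have := (H x (by rw [mem_ball_iff_norm]; linarith)).1 hx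
      linarith
  have hAm : MeasurableSet (ω ∩ ball p ρ) := hω.measurableSet.inter measurableSet_ball
  refine ⟨ρ, hρ, ?_⟩
  have hVB : volume (ball (p + τ • u) ρ) ≠ ⊤ := measure_ball_lt_top.ne
  have hVA : volume (ω ∩ ball p ρ) ≠ ⊤ :=
    ((measure_mono inter_subset_right).trans_lt measure_ball_lt_top).ne
  have hAB : Rel N ω (ω ∩ ball p ρ) (ball (p + τ • u) ρ) := by
    obtain ⟨C, hC, hBB⟩ := rel_ball (N := N) hω (p + τ • u) ρ hBω
    refine ⟨2 * volume (ball (p + τ • u) ρ) * ‖τ • u‖ₑ ^ 2 + 2 * C, by finiteness,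
      fun v hm hd => ?_⟩
    set B := ball (p + τ • u) ρ with hB
    have m2 := meas2 hm
    have mC : Measurable fun b => ∫⁻ c in B, ‖v b - v c‖ₑ ^ 2 := m2.lintegral_prod_right'
    have h1 : ∀ x b, ∫⁻ c in B, ‖v x - v c‖ₑ ^ 2 ≤
        2 * volume B * ‖v b - v x‖ₑ ^ 2 + 2 * ∫⁻ c in B, ‖v b - v c‖ₑ ^ 2 := by
      intro x b
      calc _ ≤ ∫⁻ c in B, (2 * ‖v x - v b‖ₑ ^ 2 + 2 * ‖v b - v c‖ₑ ^ 2) :=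
            lintegral_mono fun c => tri _ _ _
        _ = _ := by
            rw [lintegral_add_left (by fun_prop), lintegral_const,
              lintegral_const_mul' _ _ (by simp), Measure.restrict_apply_univ,
              ← enorm_neg, neg_sub]
            ring
    have h2 : ∫⁻ x in ω ∩ ball p ρ, ∫⁻ c in B, ‖v (x + τ • u) - v c‖ₑ ^ 2 ≤
        ∫⁻ x in B, ∫⁻ c in B, ‖v x - v c‖ₑ ^ 2 := by
      rw [← lintegral_indicator hAm, ← lintegral_indicator measurableSet_ball,
        ← lintegral_add_right_eq_self (μ := volume) ((ball (p + τ • u) ρ).indicator _) (τ • u)]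
      refine lintegral_mono fun x => ?_
      by_cases hx : x ∈ ω ∩ ball p ρ
      · rw [indicator_of_mem hx, indicator_of_mem]
        have := hx.2
        simpa [hB] using this
      · rw [indicator_of_notMem hx]; exact zero_le
    calc _ ≤ ∫⁻ x in ω ∩ ball p ρ, (2 * volume B * ‖v (x + τ • u) - v x‖ₑ ^ 2 +
          2 * ∫⁻ c in B, ‖v (x + τ • u) - v c‖ₑ ^ 2) := lintegral_mono fun x => h1 x _
      _ = 2 * volume B * (∫⁻ x in ω ∩ ball p ρ, ‖v (x + τ • u) - v x‖ₑ ^ 2) +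
          2 * ∫⁻ x in ω ∩ ball p ρ, ∫⁻ c in B, ‖v (x + τ • u) - v c‖ₑ ^ 2 := by
          rw [lintegral_add_left (by fun_prop), lintegral_const_mul' _ _ (by finiteness),
            lintegral_const_mul' _ _ (by simp)]
      _ ≤ 2 * volume B * (‖τ • u‖ₑ ^ 2 * Dir ω v) + 2 * (C * Dir ω v) := by
          gcongr
          · exact transl hω hd hAm _ hseg
          · exact h2.trans (hBB v hm hd)
      _ = _ := by ring
  exact hAB.trans (Q_extend hω hc hρ hr0 hBω hb0) hVA (measure_ball_pos _ _ hρ).ne' hVB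
    measure_ball_lt_top.ne

lemma poincare (N : ℕ) (hω : IsOpen ω) (hc : IsConnected ω) (hb : Bornology.IsBounded ω)
    (hl : LipschitzBoundary ω) :
    ∃ C : ℝ≥0∞, C ≠ ⊤ ∧ ∀ v : EuclideanSpace ℝ (Fin m) → EuclideanSpace ℝ (Fin N),
      Measurable v → DifferentiableOn ℝ v ω →
        ∃ a, ∫⁻ x in ω, ‖v x - a‖ₑ ^ 2 ≤ C * Dir ω v := by
  obtain ⟨x0, hx0⟩ := hc.nonempty
  obtain ⟨r0, hr0, hb0⟩ := Metric.isOpen_iff.1 hω x0 hx0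
  have hrel : Rel N ω (ω ∩ closure ω) (ball x0 r0) := by
    refine hb.isCompact_closure.induction_on (p := fun s => Rel N ω (ω ∩ s) (ball x0 r0))
      ?_ ?_ ?_ ?_
    · exact ⟨0, by simp, fun v _ _ => by simp⟩
    · intro s t hst h
      exact h.mono (inter_subset_inter_right _ hst) subset_rfl
    · intro s t hs ht
      rw [inter_union_distrib_left]
      exact hs.union ht
    · intro x hx
      by_cases hxω : x ∈ ω
      · obtain ⟨r, hr, hxr⟩ := Metric.isOpen_iff.1 hω x hxω
        exact ⟨ball x r, mem_nhdsWithin_of_mem_nhds (ball_mem_nhds x hr),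
          (Q_extend hω hc.isPreconnected hr hr0 hxr hb0).mono inter_subset_right subset_rfl⟩
      · have hf : x ∈ frontier ω := by
          rw [hω.frontier_eq]; exact ⟨hx, hxω⟩
        obtain ⟨ρ, hρ, h⟩ := bdry (N := N) hω hc.isPreconnected hl hr0 hb0 hf
        exact ⟨ball x ρ, mem_nhdsWithin_of_mem_nhds (ball_mem_nhds x hρ), h⟩
  rw [inter_eq_left.2 subset_closure] at hrel
  obtain ⟨C, hC, h⟩ := hrel.symm
  have hV0 : volume (ball x0 r0) ≠ 0 := (measure_ball_pos _ _ hr0).ne'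
  have hV : volume (ball x0 r0) ≠ ⊤ := measure_ball_lt_top.ne
  refine ⟨C / volume (ball x0 r0), ENNReal.div_ne_top hC hV0, fun v hm hd => ?_⟩
  have mC : Measurable fun b => ∫⁻ x in ω, ‖v b - v x‖ₑ ^ 2 := (meas2 hm).lintegral_prod_right'
  obtain ⟨b, -, hb⟩ := exists_le_setLAverage hV0 hV mC.aemeasurable
  refine ⟨v b, ?_⟩
  have e : ∀ x, ‖v x - v b‖ₑ ^ 2 = ‖v b - v x‖ₑ ^ 2 := fun x => by rw [← enorm_neg, neg_sub]
  simp_rw [e]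
  refine hb.trans ?_
  rw [setLAverage_eq]
  refine (ENNReal.div_le_div_right (h v hm hd) _).trans (le_of_eq ?_)
  simp only [div_eq_mul_inv]; ring

/-- Two-set Chebyshev: if near `z` (radius `δ`) the potential is `≥ c`, the measure of `ω` is
controlled. -/
lemma cheb {W : EuclideanSpace ℝ (Fin N) → ℝ≥0∞} (hW : Measurable W)
    {v : EuclideanSpace ℝ (Fin m) → EuclideanSpace ℝ (Fin N)} (hm : Measurable v)
    (z : EuclideanSpace ℝ (Fin N)) {δ : ℝ} (hδ : 0 < δ) (c : ℝ≥0∞)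
    (h : ∀ y, ‖y - z‖ < δ → c ≤ W y) :
    min (ENNReal.ofReal δ ^ 2) c * volume ω ≤
      (∫⁻ x in ω, ‖v x - z‖ₑ ^ 2) + ∫⁻ x in ω, W (v x) := by
  rw [← lintegral_add_left (by fun_prop), ← setLIntegral_const]
  refine lintegral_mono fun x => ?_
  by_cases hx : ‖v x - z‖ < δ
  · exact (min_le_right _ _).trans ((h _ hx).trans le_add_self)
  · refine (min_le_left _ _).trans (le_trans ?_ le_self_add)
    gcongr
    rw [← ofReal_norm]
    exact ENNReal.ofReal_le_ofReal (not_lt.1 hx)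

lemma modify (hω : IsOpen ω) (hne : ω.Nonempty) (hb : Bornology.IsBounded ω)
    {W : EuclideanSpace ℝ (Fin N) → ℝ≥0∞} (hW : Measurable W) {k : ℝ≥0∞}
    {v : EuclideanSpace ℝ (Fin m) → EuclideanSpace ℝ (Fin N)} (hk : eExt W ω v < k) :
    ∃ u : EuclideanSpace ℝ (Fin m) → EuclideanSpace ℝ (Fin N), Measurable u ∧
      DifferentiableOn ℝ u ω ∧ EqOn u v ω ∧ Dir ω u ≤ volume ω * k ∧
      ∫⁻ x in ω, W (u x) ≤ volume ω * k := by
  have hH : MemH1 ω v := by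
    by_contra h
    simp [eExt, h] at hk
  rw [eExt, if_pos hH, eAvg] at hk
  have hV0 : volume ω ≠ 0 := (hω.measure_pos volume hne).ne'
  have hV : volume ω ≠ ⊤ := hb.measure_lt_top.ne
  have heq : EqOn (ω.indicator v) v ω := fun x hx => indicator_of_mem hx v
  have hum : Measurable (ω.indicator v) := by
    classical
    rw [← piecewise_eq_indicator]
    exact hH.1.continuousOn.measurable_piecewise continuousOn_const hω.measurableSet
  have hE : (∫⁻ x in ω, ((‖fderivWithin ℝ v ω x‖₊ : ℝ≥0∞) ^ 2 + W (v x))) =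
      Dir ω (ω.indicator v) + ∫⁻ x in ω, W (ω.indicator v x) := by
    rw [Dir, ← lintegral_add_right _ (by fun_prop)]
    refine setLIntegral_congr_fun hω.measurableSet fun x hx => ?_
    have h1 : ω.indicator v =ᶠ[𝓝 x] v := by
      filter_upwards [hω.mem_nhds hx] with y hy using heq hy
    simp only [h1.fderiv_eq, fderivWithin_of_isOpen hω hx, heq hx]
    rfl
  have hle : Dir ω (ω.indicator v) + ∫⁻ x in ω, W (ω.indicator v x) ≤ volume ω * k := by
    rw [← hE]
    calc _ = volume ω * ((volume ω)⁻¹ *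
        ∫⁻ x in ω, ((‖fderivWithin ℝ v ω x‖₊ : ℝ≥0∞) ^ 2 + W (v x))) := by
          rw [← mul_assoc, ENNReal.mul_inv_cancel hV0 hV, one_mul]
      _ ≤ _ := by gcongr
  exact ⟨ω.indicator v, hum, hH.1.congr heq, heq, le_self_add.trans hle, le_add_self.trans hle⟩

end PoincareAux

/-- With `Σ ⊂ L²(ω,ℝ^N)` the set of constant maps with value a well of `W`:
for every `ε > 0`, `k_ε := inf { e(v) : dist_{L²}(v, Σ) ≥ ε } > 0`. The condition
`dist_{L²}(v,Σ) ≥ ε` is expressed as `∫_ω |v - z|² ≥ ε²` for every well `z` of `W`. -/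
theorem eExt_pos_away_from_wells {m N : ℕ} (ω : Set (EuclideanSpace ℝ (Fin m)))
    (hωo : IsOpen ω) (hωc : IsConnected ω) (hωb : Bornology.IsBounded ω)
    (hωl : LipschitzBoundary ω)
    (W : EuclideanSpace ℝ (Fin N) → ℝ≥0∞) (hlsc : LowerSemicontinuous W)
    (hH2 : ∃ c : ℝ≥0∞, 0 < c ∧ ∃ R : ℝ, ∀ z : EuclideanSpace ℝ (Fin N), R ≤ ‖z‖ → c ≤ W z) :
    ∀ ε : ℝ, 0 < ε → ∃ k : ℝ≥0∞, 0 < k ∧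
      ∀ v : EuclideanSpace ℝ (Fin m) → EuclideanSpace ℝ (Fin N),
        (∀ z : EuclideanSpace ℝ (Fin N), W z = 0 →
          ENNReal.ofReal (ε ^ 2) ≤ ∫⁻ x in ω, (‖v x - z‖₊ : ℝ≥0∞) ^ 2) →
        k ≤ eExt W ω v := by

  intro ε hε
  by_contra hcon
  push Not at hcon
  obtain ⟨C, hC, hP⟩ := PoincareAux.poincare N hωo hωc hωb hωl
  have hW : Measurable W := hlsc.measurable
  have hV0 : volume ω ≠ 0 := (hωo.measure_pos volume hωc.nonempty).ne'
  have hV : volume ω ≠ ⊤ := hωb.measure_lt_top.ne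
  have hk : ∀ n : ℕ, (0 : ℝ≥0∞) < ((n : ℝ≥0∞))⁻¹ := fun n => by simp
  choose v hvz hve using fun n : ℕ => hcon _ (hk n)
  choose u hum hud hueq huD huW using fun n : ℕ =>
    PoincareAux.modify hωo hωc.nonempty hωb hW (hve n)
  choose a ha using fun n : ℕ => hP (u n) (hum n) (hud n)
  have hη : Tendsto (fun n : ℕ => volume ω * ((n : ℝ≥0∞))⁻¹) atTop (𝓝 0) := by
    simpa using ENNReal.Tendsto.const_mul ENNReal.tendsto_inv_nat_nhds_zero (Or.inr hV)
  have htW : Tendsto (fun n => ∫⁻ x in ω, W (u n x)) atTop (𝓝 0) :=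
    tendsto_of_tendsto_of_tendsto_of_le_of_le tendsto_const_nhds hη (fun _ => zero_le) huW
  have hta : Tendsto (fun n => ∫⁻ x in ω, ‖u n x - a n‖ₑ ^ 2) atTop (𝓝 0) := by
    have h1 : Tendsto (fun n : ℕ => C * (volume ω * ((n : ℝ≥0∞))⁻¹)) atTop (𝓝 0) := by
      simpa using ENNReal.Tendsto.const_mul hη (Or.inr hC)
    refine tendsto_of_tendsto_of_tendsto_of_le_of_le tendsto_const_nhds h1 (fun _ => zero_le)
      fun n => (ha n).trans ?_
    exact mul_le_mul_right (huD n) _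
  -- boundedness of the reference values
  obtain ⟨c, hc, R, hR⟩ := hH2
  have hbd : ∀ᶠ n in atTop, a n ∈ ball (0 : EuclideanSpace ℝ (Fin N)) (R + 1) := by
    have hpos : (0 : ℝ≥0∞) < min (ENNReal.ofReal 1 ^ 2) c * volume ω :=
      ENNReal.mul_pos (lt_min (by simp) hc).ne' hV0
    have hs := hta.add htW
    rw [add_zero] at hs
    filter_upwards [hs.eventually_lt_const hpos] with n hn
    by_contra hna
    rw [mem_ball_zero_iff, not_lt] at hna
    refine absurd hn (not_lt.2 (PoincareAux.cheb hW (hum n) (a n) one_pos c ?_))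
    intro y hy
    apply hR
    have := norm_sub_norm_le (a n) y
    rw [norm_sub_rev] at this
    linarith
  obtain ⟨z, -, φ, hφ, hz⟩ := tendsto_subseq_of_frequently_bounded isBounded_ball hbd.frequently
  have htz : Tendsto (fun n => ∫⁻ x in ω, ‖u (φ n) x - z‖ₑ ^ 2) atTop (𝓝 0) := by
    have h1 := hta.comp hφ.tendsto_atTop
    have h2 : Tendsto (fun n => ‖a (φ n) - z‖ₑ ^ 2) atTop (𝓝 0) := by
      have h3 : Tendsto (fun n => a (φ n) - z) atTop (𝓝 0) := by
        simpa using hz.sub_const z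
      have h4 := (continuous_enorm.tendsto (0 : EuclideanSpace ℝ (Fin N))).comp h3
      simpa [Function.comp_def] using ((ENNReal.continuous_pow 2).tendsto _).comp h4
    have h5 : Tendsto (fun n => 2 * (∫⁻ x in ω, ‖u (φ n) x - a (φ n)‖ₑ ^ 2) +
        2 * volume ω * ‖a (φ n) - z‖ₑ ^ 2) atTop (𝓝 0) := by
      have h6 := ENNReal.Tendsto.const_mul (a := 2) h1 (Or.inr (by simp))
      have h7 := ENNReal.Tendsto.const_mul (a := 2 * volume ω) h2 (Or.inr (by finiteness))
      simpa using h6.add h7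
    refine tendsto_of_tendsto_of_tendsto_of_le_of_le tendsto_const_nhds h5 (fun _ => zero_le)
      fun n => ?_
    calc _ ≤ ∫⁻ x in ω, (2 * ‖u (φ n) x - a (φ n)‖ₑ ^ 2 + 2 * ‖a (φ n) - z‖ₑ ^ 2) :=
          lintegral_mono fun x => PoincareAux.tri _ _ _
      _ = _ := by
          rw [lintegral_add_right _ measurable_const, lintegral_const_mul' _ _ (by simp),
            lintegral_const, Measure.restrict_apply_univ]
          ring
  by_cases hWz : W z = 0
  · have hpos : (0 : ℝ≥0∞) < ENNReal.ofReal (ε ^ 2) := by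
      rw [ENNReal.ofReal_pos]; positivity
    obtain ⟨n, hn⟩ := (htz.eventually_lt_const hpos).exists
    refine absurd (hvz (φ n) z hWz) (not_le.2 (lt_of_le_of_lt (le_of_eq ?_) hn))
    refine setLIntegral_congr_fun hωo.measurableSet fun x hx => ?_
    simp only [hueq (φ n) hx]
    rfl
  · obtain ⟨c', hc', hc'z⟩ := exists_between (pos_iff_ne_zero.2 hWz)
    obtain ⟨δ, hδ, hball⟩ := Metric.eventually_nhds_iff.1 (hlsc z c' hc'z)
    have hpos : (0 : ℝ≥0∞) < min (ENNReal.ofReal δ ^ 2) c' * volume ω :=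
      ENNReal.mul_pos (lt_min (by
        have := ENNReal.ofReal_pos.2 hδ
        exact ENNReal.pow_pos this 2) hc').ne' hV0
    have hs := htz.add (htW.comp hφ.tendsto_atTop)
    rw [add_zero] at hs
    obtain ⟨n, hn⟩ := (hs.eventually_lt_const hpos).exists
    refine absurd hn (not_lt.2 (PoincareAux.cheb hW (hum (φ n)) z hδ c' ?_))
    intro y hy
    exact (hball (by rwa [dist_eq_norm])).le
end

section
/- Let ω ⊂ ℝ^{d−1} be open bounded connected with Lipschitz boundary, W : ℝ^N → [0,∞] lower semicontinuous satisfying (H1) and (H2), and u ∈ H¹_loc(ℝ × ω, ℝ^N) with E(u) = ∫_{ℝ×ω}(|∇u|² + W(u)) dx < ∞. Then there exist u⁻, u⁺ ∈ ℝ^N with W(u^±) = 0 such that ‖u(x₁,·) − u^±‖_{L²(ω,ℝ^N)} → 0 as x₁ → ±∞. -/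
open MeasureTheory Metric Set Filter Topology
open scoped ENNReal NNReal RealInnerProductSpace

/-- Cauchy-Schwarz against the constant one. -/
lemma cs_one {α : Type*} [MeasurableSpace α] (μ : Measure α) (f : α → ℝ≥0∞)
    (hf : AEMeasurable f μ) : (∫⁻ x, f x ∂μ) ^ 2 ≤ μ univ * ∫⁻ x, f x ^ 2 ∂μ := by
  have h := ENNReal.lintegral_mul_le_Lp_mul_Lq μ (Real.HolderConjugate.two_two) hf
    (aemeasurable_const (b := (1:ℝ≥0∞)))
  simp only [Pi.mul_apply, mul_one, ENNReal.one_rpow, lintegral_const, one_mul] at h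
  have h2 := pow_le_pow_left₀ (zero_le) h 2
  refine h2.trans (le_of_eq ?_)
  rw [mul_pow, ← ENNReal.rpow_natCast, ← ENNReal.rpow_mul, ← ENNReal.rpow_natCast,
    ← ENNReal.rpow_mul]
  norm_num
  rw [mul_comm]

lemma sq_add_le (a b : ℝ≥0∞) : (a + b) ^ 2 ≤ 2 * a ^ 2 + 2 * b ^ 2 := by
  have h := ENNReal.rpow_add_le_mul_rpow_add_rpow a b (p := 2) (by norm_num)
  norm_num at h
  rw [mul_add] at h
  exact h

lemma enorm_sq_le {F : Type*} [NormedAddCommGroup F] (a b : F) :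
    ‖a + b‖ₑ ^ 2 ≤ 2 * ‖a‖ₑ ^ 2 + 2 * ‖b‖ₑ ^ 2 :=
  (pow_le_pow_left₀ zero_le (enorm_add_le a b) 2).trans (sq_add_le _ _)

/-- translation estimate -/
lemma trans_est {m N : ℕ} (ω : Set (EuclideanSpace ℝ (Fin m))) (hω : IsOpen ω)
    (v : EuclideanSpace ℝ (Fin m) → EuclideanSpace ℝ (Fin N))
    (hv : DifferentiableOn ℝ v ω) (A : Set (EuclideanSpace ℝ (Fin m))) (hA : MeasurableSet A)
    (h : EuclideanSpace ℝ (Fin m)) (hAh : ∀ x ∈ A, ∀ τ ∈ Icc (0:ℝ) 1, x + τ • h ∈ ω) :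
    ∫⁻ x in A, ‖v (x + h) - v x‖ₑ ^ 2 ≤ ‖h‖ₑ ^ 2 * ∫⁻ x in ω, ‖fderivWithin ℝ v ω x‖ₑ ^ 2 := by
  set D : EuclideanSpace ℝ (Fin m) → ℝ≥0∞ := ω.indicator (fun x => ‖fderiv ℝ v x‖ₑ ^ 2) with hD
  have hDm : Measurable D :=
    (((measurable_fderiv ℝ v).enorm).pow_const 2).indicator hω.measurableSet
  have hDi : ∫⁻ x in ω, ‖fderivWithin ℝ v ω x‖ₑ ^ 2 = ∫⁻ x, D x := by
    rw [hD, lintegral_indicator hω.measurableSet]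
    exact setLIntegral_congr_fun hω.measurableSet
      (fun x hx => by simp only [fderivWithin_of_isOpen hω hx])
  rw [hDi]
  have key : ∀ x ∈ A, ‖v (x + h) - v x‖ₑ ^ 2 ≤ ‖h‖ₑ ^ 2 * ∫⁻ τ in Icc (0:ℝ) 1, D (x + τ • h) := by
    intro x hx
    have hline : Measurable (fun τ : ℝ => x + τ • h) := by fun_prop
    have hmeas : Measurable (fun τ : ℝ => fderiv ℝ v (x + τ • h) h) :=
      (measurable_fderiv_apply_const ℝ v h).comp hline
    have h1 : ‖v (x + h) - v x‖ₑ ≤ ∫⁻ τ in Icc (0:ℝ) 1, ‖fderiv ℝ v (x + τ • h) h‖ₑ := by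
      by_cases hfin : ∫⁻ τ in Icc (0:ℝ) 1, ‖fderiv ℝ v (x + τ • h) h‖ₑ = ⊤
      · rw [hfin]; exact le_top
      · have hint : IntegrableOn (fun τ : ℝ => fderiv ℝ v (x + τ • h) h) (Icc 0 1) :=
          ⟨hmeas.aestronglyMeasurable, lt_top_iff_ne_top.2 hfin⟩
        have hd : ∀ τ ∈ uIcc (0:ℝ) 1,
            HasDerivAt (fun τ : ℝ => v (x + τ • h)) (fderiv ℝ v (x + τ • h) h) τ := by
          intro τ hτ
          rw [uIcc_of_le zero_le_one] at hτ
          have hmem := hAh x hx τ hτ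
          have h2 : HasFDerivAt v (fderiv ℝ v (x + τ • h)) (x + τ • h) :=
            ((hv _ hmem).differentiableAt (hω.mem_nhds hmem)).hasFDerivAt
          have h3 : HasDerivAt (fun τ : ℝ => x + τ • h) h τ := by
            simpa using ((hasDerivAt_id τ).smul_const h).const_add x
          exact h2.comp_hasDerivAt τ h3
        have := intervalIntegral.integral_eq_sub_of_hasDerivAt hd
          ((intervalIntegrable_iff_integrableOn_Icc_of_le zero_le_one).2 hint)
        simp only [one_smul, zero_smul, add_zero] at this
        rw [← this, intervalIntegral.integral_of_le zero_le_one, ← integral_Icc_eq_integral_Ioc]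
        exact enorm_integral_le_lintegral_enorm _
    calc _ ≤ (∫⁻ τ in Icc (0:ℝ) 1, ‖fderiv ℝ v (x + τ • h) h‖ₑ) ^ 2 :=
          pow_le_pow_left₀ zero_le h1 2
      _ ≤ volume.restrict (Icc (0:ℝ) 1) univ * ∫⁻ τ in Icc (0:ℝ) 1, ‖fderiv ℝ v (x + τ • h) h‖ₑ ^ 2 :=
          cs_one _ _ hmeas.enorm.aemeasurable
      _ = ∫⁻ τ in Icc (0:ℝ) 1, ‖fderiv ℝ v (x + τ • h) h‖ₑ ^ 2 := by simp
      _ ≤ ∫⁻ τ in Icc (0:ℝ) 1, ‖h‖ₑ ^ 2 * D (x + τ • h) := by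
          refine setLIntegral_mono' measurableSet_Icc fun τ hτ => ?_
          rw [hD, indicator_of_mem (hAh x hx τ hτ), ← mul_pow, mul_comm]
          exact pow_le_pow_left₀ zero_le (ContinuousLinearMap.le_opENorm _ _) 2
      _ = _ := lintegral_const_mul _ (hDm.comp hline)
  have hj : Measurable (fun p : EuclideanSpace ℝ (Fin m) × ℝ => D (p.1 + p.2 • h)) :=
    hDm.comp (by fun_prop)
  calc _ ≤ ∫⁻ x in A, ‖h‖ₑ ^ 2 * ∫⁻ τ in Icc (0:ℝ) 1, D (x + τ • h) := setLIntegral_mono' hA key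
    _ ≤ ∫⁻ x, ‖h‖ₑ ^ 2 * ∫⁻ τ in Icc (0:ℝ) 1, D (x + τ • h) := setLIntegral_le_lintegral _ _
    _ = ‖h‖ₑ ^ 2 * ∫⁻ x, ∫⁻ τ in Icc (0:ℝ) 1, D (x + τ • h) :=
        lintegral_const_mul _ hj.lintegral_prod_right'
    _ = ‖h‖ₑ ^ 2 * ∫⁻ τ in Icc (0:ℝ) 1, ∫⁻ x, D (x + τ • h) := by
        rw [lintegral_lintegral_swap]; exact hj.aemeasurable
    _ = ‖h‖ₑ ^ 2 * ∫⁻ x, D x := by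
        simp only [lintegral_add_right_eq_self]
        simp

/-- Control of the `L²` norm on `A` by that on `B` and the gradient. -/
def PP {m : ℕ} (N : ℕ) (ω B A : Set (EuclideanSpace ℝ (Fin m))) : Prop :=
  ∃ C : ℝ≥0, ∀ v : EuclideanSpace ℝ (Fin m) → EuclideanSpace ℝ (Fin N), Measurable v →
    DifferentiableOn ℝ v ω →
    ∫⁻ x in A, ‖v x‖ₑ ^ 2 ≤ C * ((∫⁻ x in B, ‖v x‖ₑ ^ 2) +
      ∫⁻ x in ω, ‖fderivWithin ℝ v ω x‖ₑ ^ 2)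

lemma PP.mono {m N : ℕ} {ω B A A' : Set (EuclideanSpace ℝ (Fin m))} (h : PP N ω B A')
    (hA : A ⊆ A') : PP N ω B A := by
  obtain ⟨C, hC⟩ := h
  exact ⟨C, fun v hv hd => (lintegral_mono_set hA).trans (hC v hv hd)⟩

lemma PP.union {m N : ℕ} {ω B A A' : Set (EuclideanSpace ℝ (Fin m))} (h : PP N ω B A)
    (h' : PP N ω B A') : PP N ω B (A ∪ A') := by
  obtain ⟨C, hC⟩ := h
  obtain ⟨C', hC'⟩ := h'
  refine ⟨C + C', fun v hv hd => (lintegral_union_le _ _ _).trans ?_⟩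
  push_cast
  rw [add_mul]
  exact add_le_add (hC v hv hd) (hC' v hv hd)

lemma PP.trans {m N : ℕ} {ω B A A' : Set (EuclideanSpace ℝ (Fin m))} (hω : IsOpen ω)
    (h' : PP N ω B A') (hA : MeasurableSet A) (hA' : MeasurableSet A')
    (h : EuclideanSpace ℝ (Fin m)) (hAh : ∀ x ∈ A, ∀ τ ∈ Icc (0:ℝ) 1, x + τ • h ∈ ω)
    (hAA : ∀ x ∈ A, x + h ∈ A') : PP N ω B A := by
  obtain ⟨C, hC⟩ := h'
  refine ⟨2 * C + 2 * ‖h‖₊ ^ 2, fun v hv hd => ?_⟩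
  have h1 := hC v hv hd
  have h2 := trans_est ω hω v hd A hA h hAh
  have hvh : Measurable fun x => v (x + h) := hv.comp (by fun_prop)
  have h3 : ∫⁻ x in A, ‖v (x + h)‖ₑ ^ 2 ≤ ∫⁻ x in A', ‖v x‖ₑ ^ 2 := by
    rw [← lintegral_indicator hA', ← lintegral_indicator hA,
      ← lintegral_add_right_eq_self (A'.indicator _) h]
    refine lintegral_mono fun x => ?_
    by_cases hx : x ∈ A
    · simp [hx, hAA x hx]
    · simp [hx]
  set G := ∫⁻ x in ω, ‖fderivWithin ℝ v ω x‖ₑ ^ 2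
  set b := ∫⁻ x in B, ‖v x‖ₑ ^ 2
  calc ∫⁻ x in A, ‖v x‖ₑ ^ 2 ≤ ∫⁻ x in A, (2 * ‖v (x + h)‖ₑ ^ 2 + 2 * ‖v (x + h) - v x‖ₑ ^ 2) := by
        refine lintegral_mono fun x => ?_
        have := enorm_sq_le (v (x + h)) (- (v (x + h) - v x))
        rw [enorm_neg] at this
        simpa using this
    _ = 2 * (∫⁻ x in A, ‖v (x + h)‖ₑ ^ 2) + 2 * ∫⁻ x in A, ‖v (x + h) - v x‖ₑ ^ 2 := by
        rw [lintegral_add_left (by fun_prop), lintegral_const_mul _ (by fun_prop),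
          lintegral_const_mul _ (by fun_prop)]
    _ ≤ 2 * (C * (b + G)) + 2 * (‖h‖ₑ ^ 2 * G) := by
        gcongr
        exact h3.trans h1
    _ ≤ 2 * (C * (b + G)) + 2 * (‖h‖ₑ ^ 2 * (b + G)) := by
        gcongr
        exact le_add_self
    _ = _ := by
        push_cast
        rw [enorm_eq_nnnorm]
        ring

lemma PP.self {m N : ℕ} {ω B : Set (EuclideanSpace ℝ (Fin m))} : PP N ω B B :=
  ⟨1, fun v hv hd => by simp⟩

lemma PP.ball {m N : ℕ} {ω : Set (EuclideanSpace ℝ (Fin m))} (hω : IsOpen ω)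
    (hc : IsPreconnected ω) (x₀ : EuclideanSpace ℝ (Fin m)) (r : ℝ) (hr : 0 < r) (hx₀ : x₀ ∈ ω) :
    ∀ x ∈ ω, ∃ ρ > 0, PP N ω (ball x₀ r) (ball x ρ) := by
  set U := {x | ∃ ρ > 0, PP N ω (Metric.ball x₀ r) (Metric.ball x ρ)} with hU
  change ω ⊆ U
  refine hc.subset_of_closure_inter_subset ?_ ⟨x₀, hx₀, r, hr, PP.self⟩ ?_
  · rw [Metric.isOpen_iff]
    rintro x ⟨ρ, hρ, h⟩
    refine ⟨ρ, hρ, fun y hy => ⟨ρ - dist y x, by simpa using hy, h.mono ?_⟩⟩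
    exact ball_subset_ball' (by linarith)
  · rintro x ⟨hx, hxω⟩
    obtain ⟨ε, hε, hball⟩ := Metric.isOpen_iff.1 hω x hxω
    obtain ⟨y, ⟨ρ, hρ, h⟩, hy⟩ := Metric.mem_closure_iff.1 hx (ε / 2) (by linarith)
    refine ⟨min ρ (ε / 2), lt_min hρ (by linarith), ?_⟩
    refine PP.trans hω h measurableSet_ball measurableSet_ball (y - x) ?_ ?_
    · intro z hz τ hτ
      apply hball
      rw [mem_ball, dist_eq_norm] at hz ⊢
      rw [dist_comm, dist_eq_norm] at hy
      have : z + τ • (y - x) - x = (z - x) + τ • (y - x) := by abel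
      rw [this]
      have h1 : ‖τ • (y - x)‖ ≤ ‖y - x‖ := by
        rw [norm_smul, Real.norm_of_nonneg hτ.1]
        exact mul_le_of_le_one_left (norm_nonneg _) hτ.2
      have := norm_add_le (z - x) (τ • (y - x))
      have := hz.trans_le (min_le_right _ _)
      linarith
    · intro z hz
      rw [mem_ball, dist_eq_norm] at hz ⊢
      have : z + (y - x) - y = z - x := by abel
      rw [this]
      exact hz.trans_le (min_le_left _ _)

lemma PP.whole {m N : ℕ} {ω : Set (EuclideanSpace ℝ (Fin m))} (hω : IsOpen ω)
    (hc : IsPreconnected ω) (hb : Bornology.IsBounded ω) (hl : LipschitzBoundary ω)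
    (x₀ : EuclideanSpace ℝ (Fin m)) (r : ℝ) (hr : 0 < r) (hx₀ : x₀ ∈ ω) :
    PP N ω (Metric.ball x₀ r) ω := by
  have hK : IsCompact (closure ω) := hb.isCompact_closure
  have main : PP N ω (Metric.ball x₀ r) (closure ω ∩ ω) := by
    refine hK.induction_on (p := fun s => PP N ω (Metric.ball x₀ r) (s ∩ ω)) ?_ ?_ ?_ ?_
    · exact ⟨0, by simp⟩
    · exact fun s t hst h => h.mono (inter_subset_inter_left _ hst)
    · intro s t hs ht
      rw [union_inter_distrib_right]
      exact hs.union ht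
    · intro p hp
      by_cases hpω : p ∈ ω
      · obtain ⟨ρ, hρ, h⟩ := PP.ball (N := N) hω hc x₀ r hr hx₀ p hpω
        exact ⟨Metric.ball p ρ, mem_nhdsWithin_of_mem_nhds (ball_mem_nhds p hρ),
          h.mono inter_subset_left⟩
      · have hpf : p ∈ frontier ω := ⟨hp, by rwa [hω.interior_eq]⟩
        obtain ⟨e, he, φ, K, R, hR, hφ, hloc⟩ := hl p hpf
        have hproj : ∀ (x : EuclideanSpace ℝ (Fin m)) (τ : ℝ),
            x + τ • e - ⟪x + τ • e, e⟫ • e = x - ⟪x, e⟫ • e := by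
          intro x τ
          rw [inner_add_left, inner_smul_left, real_inner_self_eq_norm_sq, he, add_smul]
          simp
        have hinn : ∀ (x : EuclideanSpace ℝ (Fin m)) (τ : ℝ), ⟪x + τ • e, e⟫ = ⟪x, e⟫ + τ := by
          intro x τ
          rw [inner_add_left, inner_smul_left, real_inner_self_eq_norm_sq, he]
          simp
        have hple : φ (p - ⟪p, e⟫ • e) ≤ ⟪p, e⟫ := by
          have hcl : IsClosed {x : EuclideanSpace ℝ (Fin m) | φ (x - ⟪x, e⟫ • e) ≤ ⟪x, e⟫} := by
            have := hφ.continuous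
            exact isClosed_le (by fun_prop) (by fun_prop)
          have hpc : p ∈ closure (ω ∩ Metric.ball p R) := by
            rw [Metric.mem_closure_iff] at hp ⊢
            intro ε hε
            obtain ⟨y, hy, hyd⟩ := hp (min ε R) (lt_min hε hR)
            exact ⟨y, ⟨hy, by rw [mem_ball, dist_comm]; exact hyd.trans_le (min_le_right _ _)⟩,
              hyd.trans_le (min_le_left _ _)⟩
          exact closure_minimal (fun x hx => ((hloc x hx.2).1 hx.1).le) hcl hpc
        have hdist : ∀ (x : EuclideanSpace ℝ (Fin m)) (τ : ℝ), dist (x + τ • e) p ≤ dist x p + |τ| := by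
          intro x τ
          rw [dist_eq_norm, dist_eq_norm]
          have : x + τ • e - p = (x - p) + τ • e := by abel
          rw [this]
          refine (norm_add_le _ _).trans ?_
          rw [norm_smul, he, mul_one, Real.norm_eq_abs]
        have hq : p + (R / 2) • e ∈ ω := by
          rw [hloc, hproj, hinn]
          · linarith
          · rw [mem_ball]
            refine (hdist _ _).trans_lt ?_
            rw [dist_self, abs_of_pos (by linarith)]
            linarith
        obtain ⟨ρ, hρ, h⟩ := PP.ball (N := N) hω hc x₀ r hr hx₀ _ hq
        refine ⟨Metric.ball p (min ρ (R / 2)), mem_nhdsWithin_of_mem_nhds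
          (ball_mem_nhds p (lt_min hρ (by linarith))), ?_⟩
        refine PP.trans hω h (measurableSet_ball.inter hω.measurableSet) measurableSet_ball
          ((R / 2) • e) ?_ ?_
        · rintro x ⟨hx, hxω⟩ τ hτ
          rw [mem_ball] at hx
          have hx2 := hx.trans_le (min_le_right _ _)
          have hxb : x ∈ Metric.ball p R := by rw [mem_ball]; linarith
          have h1 := (hloc x hxb).1 hxω
          rw [smul_smul]
          have hτ0 : 0 ≤ τ * (R / 2) := mul_nonneg hτ.1 (by linarith)
          have hτ1 : τ * (R / 2) ≤ R / 2 := mul_le_of_le_one_left (by linarith) hτ.2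
          rw [hloc, hproj, hinn]
          · linarith
          · rw [mem_ball]
            refine (hdist _ _).trans_lt ?_
            rw [abs_of_nonneg hτ0]
            linarith
        · rintro x ⟨hx, hxω⟩
          rw [mem_ball] at hx ⊢
          rw [dist_add_right]
          exact hx.trans_le (min_le_left _ _)
  rwa [inter_eq_right.2 subset_closure] at main


lemma wells {N : ℕ} (W : EuclideanSpace ℝ (Fin N) → ℝ≥0∞) (hlsc : LowerSemicontinuous W)
    (hH2 : ∃ c : ℝ≥0∞, 0 < c ∧ ∃ R : ℝ, ∀ z : EuclideanSpace ℝ (Fin N), R ≤ ‖z‖ → c ≤ W z)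
    (ε : ℝ≥0∞) (hε : ε ≠ 0) :
    ∃ δ : ℝ≥0∞, δ ≠ 0 ∧ ∀ c, W c < δ → ∃ z, W z = 0 ∧ ‖c - z‖ₑ ^ 2 ≤ ε := by
  obtain ⟨c, hc, R, hR⟩ := hH2
  obtain ⟨n, hn, hnε⟩ := ENNReal.exists_nnreal_pos_mul_lt (a := 1) ENNReal.one_ne_top hε
  rw [mul_one] at hnε
  set U : Set (EuclideanSpace ℝ (Fin N)) := {x | ∃ z, W z = 0 ∧ ‖x - z‖ₑ ^ 2 < ε} with hU
  have hUo : IsOpen U := by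
    have : U = ⋃ z ∈ {z | W z = 0}, {x | ‖x - z‖ₑ ^ 2 < ε} := by
      ext x; simp [hU]
    rw [this]
    refine isOpen_biUnion fun z _ => isOpen_lt ?_ continuous_const
    exact (ENNReal.continuous_pow 2).comp (by fun_prop)
  have hZU : ∀ z, W z = 0 → z ∈ U := fun z hz => ⟨z, hz, by simpa using pos_iff_ne_zero.2 hε⟩
  have hK : IsCompact (closedBall (0 : EuclideanSpace ℝ (Fin N)) R \ U) :=
    (isCompact_closedBall 0 R).diff hUo
  obtain hemp | hne := (closedBall (0 : EuclideanSpace ℝ (Fin N)) R \ U).eq_empty_or_nonempty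
  · refine ⟨c, hc.ne', fun x hx => ?_⟩
    by_cases hxU : x ∈ U
    · obtain ⟨z, hz, h⟩ := hxU
      exact ⟨z, hz, h.le⟩
    · exfalso
      by_cases hxR : R ≤ ‖x‖
      · exact absurd (hR x hxR) (not_le.2 hx)
      · have : x ∈ closedBall (0 : EuclideanSpace ℝ (Fin N)) R \ U :=
          ⟨by simpa using (not_le.1 hxR).le, hxU⟩
        rw [hemp] at this
        exact this
  · obtain ⟨a, ha, hmin⟩ := (hlsc.lowerSemicontinuousOn _).exists_isMinOn hne hK
    have haW : W a ≠ 0 := fun h => ha.2 (hZU a h)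
    refine ⟨min c (W a), (lt_min hc (pos_iff_ne_zero.2 haW)).ne', fun x hx => ?_⟩
    by_cases hxU : x ∈ U
    · obtain ⟨z, hz, h⟩ := hxU
      exact ⟨z, hz, h.le⟩
    · exfalso
      by_cases hxR : R ≤ ‖x‖
      · exact absurd (hR x hxR) (not_le.2 (hx.trans_le (min_le_left _ _)))
      · have : x ∈ closedBall (0 : EuclideanSpace ℝ (Fin N)) R \ U :=
          ⟨by simpa using (not_le.1 hxR).le, hxU⟩
        exact absurd (hmin this) (not_le.2 (hx.trans_le (min_le_right _ _)))

lemma poincare {m N : ℕ} {ω : Set (EuclideanSpace ℝ (Fin m))} (hω : IsOpen ω)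
    (hc : IsPreconnected ω) (hb : Bornology.IsBounded ω) (hl : LipschitzBoundary ω)
    (x₀ : EuclideanSpace ℝ (Fin m)) (r : ℝ) (hr : 0 < r) (hx₀ : ball x₀ (3 * r) ⊆ ω) :
    ∃ C : ℝ≥0∞, C ≠ ⊤ ∧ ∀ v : EuclideanSpace ℝ (Fin m) → EuclideanSpace ℝ (Fin N), Measurable v →
      DifferentiableOn ℝ v ω → ∫⁻ y in ball x₀ r, ∫⁻ x in ω, ‖v x - v y‖ₑ ^ 2 ≤
        C * ∫⁻ x in ω, ‖fderivWithin ℝ v ω x‖ₑ ^ 2 := by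
  obtain ⟨C, hC⟩ := PP.whole (N := N) hω hc hb hl x₀ r hr (hx₀ (mem_ball_self (by linarith)))
  set b := volume (ball x₀ r)
  set b2 := volume (ball (0 : EuclideanSpace ℝ (Fin m)) (2 * r))
  have hbt : b ≠ ⊤ := measure_ball_lt_top.ne
  have hb2t : b2 ≠ ⊤ := measure_ball_lt_top.ne
  refine ⟨C * (b2 * ENNReal.ofReal (2 * r) ^ 2 + b), by finiteness, fun v hv hd => ?_⟩
  set G := ∫⁻ x in ω, ‖fderivWithin ℝ v ω x‖ₑ ^ 2 with hG
  have hstep : ∀ y, ∫⁻ x in ω, ‖v x - v y‖ₑ ^ 2 ≤ C * ((∫⁻ x in ball x₀ r, ‖v x - v y‖ₑ ^ 2) + G) := by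
    intro y
    have := hC (fun x => v x - v y) (by fun_prop) (hd.sub_const _)
    simpa only [fderivWithin_sub_const] using this
  have hj : Measurable (fun p : EuclideanSpace ℝ (Fin m) × EuclideanSpace ℝ (Fin m) =>
      ‖v p.2 - v p.1‖ₑ ^ 2) := by fun_prop
  have hdd : ∫⁻ y in ball x₀ r, ∫⁻ x in ball x₀ r, ‖v x - v y‖ₑ ^ 2 ≤
      b2 * ENNReal.ofReal (2 * r) ^ 2 * G := by
    have h1 : ∀ y ∈ ball x₀ r, ∫⁻ x in ball x₀ r, ‖v x - v y‖ₑ ^ 2 ≤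
        ∫⁻ h in ball (0 : EuclideanSpace ℝ (Fin m)) (2 * r), ‖v (y + h) - v y‖ₑ ^ 2 := by
      intro y hy
      rw [← lintegral_indicator measurableSet_ball, ← lintegral_indicator measurableSet_ball,
        ← lintegral_add_left_eq_self _ y]
      refine lintegral_mono fun h => ?_
      by_cases hh : y + h ∈ ball x₀ r
      · have : h ∈ ball (0 : EuclideanSpace ℝ (Fin m)) (2 * r) := by
          rw [mem_ball, dist_eq_norm] at *
          have e : h - 0 = (y + h - x₀) - (y - x₀) := by abel
          rw [e]
          have := norm_sub_le (y + h - x₀) (y - x₀)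
          linarith
        simp [hh, this]
      · simp [hh]
    have hj2 : Measurable (fun p : EuclideanSpace ℝ (Fin m) × EuclideanSpace ℝ (Fin m) =>
      ‖v (p.1 + p.2) - v p.1‖ₑ ^ 2) := by fun_prop
    calc _ ≤ ∫⁻ y in ball x₀ r, ∫⁻ h in ball (0 : EuclideanSpace ℝ (Fin m)) (2 * r),
          ‖v (y + h) - v y‖ₑ ^ 2 := setLIntegral_mono' measurableSet_ball h1
      _ = ∫⁻ h in ball (0 : EuclideanSpace ℝ (Fin m)) (2 * r), ∫⁻ y in ball x₀ r,
          ‖v (y + h) - v y‖ₑ ^ 2 := lintegral_lintegral_swap hj2.aemeasurable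
      _ ≤ ∫⁻ h in ball (0 : EuclideanSpace ℝ (Fin m)) (2 * r), ENNReal.ofReal (2 * r) ^ 2 * G := by
          refine setLIntegral_mono' measurableSet_ball fun h hh => ?_
          rw [mem_ball_zero_iff] at hh
          refine (trans_est ω hω v hd _ measurableSet_ball h ?_).trans ?_
          · intro x hx τ hτ
            apply hx₀
            rw [mem_ball, dist_eq_norm] at *
            have e : x + τ • h - x₀ = (x - x₀) + τ • h := by abel
            rw [e]
            have h1 : ‖τ • h‖ ≤ ‖h‖ := by
              rw [norm_smul, Real.norm_of_nonneg hτ.1]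
              exact mul_le_of_le_one_left (norm_nonneg _) hτ.2
            have := norm_add_le (x - x₀) (τ • h)
            linarith
          · gcongr
            rw [← ofReal_norm]
            exact ENNReal.ofReal_le_ofReal hh.le
      _ = _ := by
          rw [setLIntegral_const]; ring
  calc _ ≤ ∫⁻ y in ball x₀ r, C * ((∫⁻ x in ball x₀ r, ‖v x - v y‖ₑ ^ 2) + G) :=
        lintegral_mono hstep
    _ = C * ((∫⁻ y in ball x₀ r, ∫⁻ x in ball x₀ r, ‖v x - v y‖ₑ ^ 2) + G * b) := by
        have hm : Measurable fun y => ∫⁻ x in ball x₀ r, ‖v x - v y‖ₑ ^ 2 :=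
          hj.lintegral_prod_right'
        rw [lintegral_const_mul _ (hm.add_const _), lintegral_add_left hm, setLIntegral_const]
    _ ≤ C * ((b2 * ENNReal.ofReal (2 * r) ^ 2 * G) + G * b) := by gcongr
    _ = _ := by ring

lemma comp_wells {m N : ℕ} {ω : Set (EuclideanSpace ℝ (Fin m))} (hω : IsOpen ω)
    (hc : IsConnected ω) (hb : Bornology.IsBounded ω) (hl : LipschitzBoundary ω)
    (W : EuclideanSpace ℝ (Fin N) → ℝ≥0∞) (hlsc : LowerSemicontinuous W)
    (hH2 : ∃ c : ℝ≥0∞, 0 < c ∧ ∃ R : ℝ, ∀ z : EuclideanSpace ℝ (Fin N), R ≤ ‖z‖ → c ≤ W z)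
    (ε : ℝ≥0∞) (hε : ε ≠ 0) :
    ∃ δ : ℝ≥0∞, δ ≠ 0 ∧ ∀ v : EuclideanSpace ℝ (Fin m) → EuclideanSpace ℝ (Fin N), Measurable v →
      DifferentiableOn ℝ v ω →
      ∫⁻ x in ω, (‖fderivWithin ℝ v ω x‖ₑ ^ 2 + W (v x)) ≤ δ →
      ∃ z, W z = 0 ∧ ∫⁻ x in ω, ‖v x - z‖ₑ ^ 2 ≤ ε := by
  obtain ⟨x₀, hx₀⟩ := hc.nonempty
  obtain ⟨r', hr', hball⟩ := Metric.isOpen_iff.1 hω x₀ hx₀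
  set r := r' / 3 with hrdef
  have hr : 0 < r := by positivity
  have hball' : ball x₀ (3 * r) ⊆ ω := by rwa [hrdef, mul_div_cancel₀ _ (by norm_num)]
  have hball1 : ball x₀ r ⊆ ω := (ball_subset_ball (by linarith)).trans hball'
  obtain ⟨C, hCt, hC⟩ := poincare (N := N) hω hc.isPreconnected hb hl x₀ r hr hball'
  have hωt : volume ω ≠ ⊤ := hb.measure_lt_top.ne
  set b := volume (ball x₀ r)
  have hbt : b ≠ ⊤ := measure_ball_lt_top.ne
  have hb0 : b ≠ 0 := (measure_ball_pos volume x₀ hr).ne'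
  have hε2 : ε / 2 ≠ 0 := by simpa using hε
  obtain ⟨n, hn, hnε⟩ := ENNReal.exists_nnreal_pos_mul_lt (a := 2 * volume ω) (by finiteness) hε2
  obtain ⟨δW, hδW0, hδW⟩ := wells W hlsc hH2 n (by simpa using hn.ne')
  obtain ⟨k, hk, hkε⟩ := ENNReal.exists_nnreal_pos_mul_lt (a := 2) (by finiteness) hε2
  set δ1 := min δW k with hδ1
  have hδ10 : δ1 ≠ 0 := (lt_min (pos_iff_ne_zero.2 hδW0) (by simpa using hk)).ne'
  obtain ⟨j, hj, hjε⟩ := ENNReal.exists_nnreal_pos_mul_lt (a := C + 1) (by finiteness)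
    (mul_ne_zero hδ10 hb0)
  refine ⟨j, by simpa using hj.ne', fun v hv hd he => ?_⟩
  have hWm : Measurable W := hlsc.measurable
  have hWv : Measurable fun x => W (v x) := hWm.comp hv
  rw [lintegral_add_right _ hWv] at he
  have hjm : Measurable (fun p : EuclideanSpace ℝ (Fin m) × EuclideanSpace ℝ (Fin m) =>
      ‖v p.2 - v p.1‖ₑ ^ 2) := by fun_prop
  have hF : ∫⁻ y in ball x₀ r, ((∫⁻ x in ω, ‖v x - v y‖ₑ ^ 2) + W (v y)) < δ1 * b := by
    rw [lintegral_add_right _ hWv]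
    refine lt_of_le_of_lt ?_ hjε
    calc _ ≤ C * j + j := by
          gcongr
          · exact (hC v hv hd).trans (by gcongr; exact le_self_add.trans he)
          · exact (lintegral_mono_set hball1).trans (le_add_self.trans he)
      _ = _ := by ring
  obtain ⟨y, hy, hFy⟩ : ∃ y ∈ ball x₀ r, (∫⁻ x in ω, ‖v x - v y‖ₑ ^ 2) + W (v y) < δ1 := by
    by_contra! hcon
    have : ∫⁻ y in ball x₀ r, δ1 ≤ ∫⁻ y in ball x₀ r, ((∫⁻ x in ω, ‖v x - v y‖ₑ ^ 2) + W (v y)) :=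
      setLIntegral_mono' measurableSet_ball hcon
    rw [setLIntegral_const] at this
    exact absurd hF (not_lt.2 this)
  obtain ⟨z, hz, hvz⟩ := hδW (v y) ((le_add_self.trans_lt hFy).trans_le (min_le_left _ _))
  refine ⟨z, hz, ?_⟩
  calc _ ≤ ∫⁻ x in ω, (2 * ‖v x - v y‖ₑ ^ 2 + 2 * ‖v y - z‖ₑ ^ 2) := by
        refine lintegral_mono fun x => ?_
        have := enorm_sq_le (v x - v y) (v y - z)
        simpa using this
    _ = 2 * (∫⁻ x in ω, ‖v x - v y‖ₑ ^ 2) + 2 * ‖v y - z‖ₑ ^ 2 * volume ω := by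
        rw [lintegral_add_right _ measurable_const, lintegral_const_mul _ (by fun_prop),
          setLIntegral_const]
    _ ≤ 2 * k + 2 * n * volume ω := by
        gcongr
        exact le_self_add.trans (hFy.le.trans (min_le_right _ _))
    _ = k * 2 + n * (2 * volume ω) := by ring
    _ ≤ ε / 2 + ε / 2 := add_le_add hkε.le hnε.le
    _ = ε := ENNReal.add_halves ε

lemma tail_small (f : ℝ → ℝ≥0∞) (hf : ∫⁻ t, f t ≠ ⊤) (ε : ℝ≥0∞) (hε : ε ≠ 0) :
    ∃ T : ℝ, ∫⁻ t in Ici T, f t < ε := by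
  set μ := (volume : Measure ℝ).withDensity f
  have hfin : IsFiniteMeasure μ := isFiniteMeasure_withDensity hf
  have h := tendsto_measure_iInter_atTop (μ := μ) (s := fun n : ℕ => Ici (n : ℝ))
    (fun n => measurableSet_Ici.nullMeasurableSet)
    (fun a b hab => Ici_subset_Ici.2 (by exact_mod_cast hab)) ⟨0, measure_ne_top _ _⟩
  have hemp : (⋂ n : ℕ, Ici (n : ℝ)) = ∅ := by
    ext x
    simp only [mem_iInter, mem_Ici, mem_empty_iff_false, iff_false, not_forall, not_le]
    exact exists_nat_gt x
  rw [hemp, measure_empty] at h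
  obtain ⟨n, hn⟩ := (h.eventually_lt_const (pos_iff_ne_zero.2 hε)).exists
  refine ⟨n, ?_⟩
  simpa [μ, withDensity_apply _ measurableSet_Ici] using hn

lemma dyn {α : Type*} [MeasurableSpace α] {N : ℕ} (μ : Measure α) (hμ : μ univ ≠ 0)
    (Z : Set (EuclideanSpace ℝ (Fin N))) (hZ : Z.Finite)
    (v : ℝ → α → EuclideanSpace ℝ (Fin N)) (hv : ∀ t, Measurable (v t))
    (e D : ℝ → ℝ≥0∞) (he : ∫⁻ t, e t ≠ ⊤) (hD : ∫⁻ t, D t ≠ ⊤)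
    (hdist : ∀ s t, s ≤ t → ∫⁻ x, ‖v t x - v s x‖ₑ ^ 2 ∂μ ≤
      ENNReal.ofReal (t - s) * ∫⁻ r in Icc s t, D r)
    (hcomp : ∀ ε : ℝ≥0∞, ε ≠ 0 → ∃ δ : ℝ≥0∞, δ ≠ 0 ∧ ∀ t, e t ≤ δ →
      ∃ z ∈ Z, ∫⁻ x, ‖v t x - z‖ₑ ^ 2 ∂μ ≤ ε) :
    ∃ z ∈ Z, Tendsto (fun t => ∫⁻ x, ‖v t x - z‖ₑ ^ 2 ∂μ) atTop (𝓝 0) := by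
  set q : ℝ → EuclideanSpace ℝ (Fin N) → ℝ≥0∞ := fun t z => ∫⁻ x, ‖v t x - z‖ₑ ^ 2 ∂μ with hq
  have hquasi : ∀ s t z, q t z ≤ 2 * (∫⁻ x, ‖v t x - v s x‖ₑ ^ 2 ∂μ) + 2 * q s z := by
    intro s t z
    have h1 := hv s
    have h2 := hv t
    calc q t z ≤ ∫⁻ x, (2 * ‖v t x - v s x‖ₑ ^ 2 + 2 * ‖v s x - z‖ₑ ^ 2) ∂μ := by
          refine lintegral_mono fun x => ?_
          have := enorm_sq_le (v t x - v s x) (v s x - z)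
          simpa using this
      _ = _ := by
          rw [lintegral_add_left (by fun_prop), lintegral_const_mul _ (by fun_prop),
            lintegral_const_mul _ (by fun_prop)]
  -- separation
  obtain ⟨ε₀, hε₀, hsep⟩ : ∃ ε₀ : ℝ≥0∞, ε₀ ≠ 0 ∧ ∀ t, ∀ z ∈ Z, ∀ z' ∈ Z, q t z ≤ ε₀ → q t z' ≤ ε₀ →
      z = z' := by
    have hev : ∀ᶠ ε : ℝ≥0∞ in 𝓝[>] 0, ∀ p ∈ Z ×ˢ Z, p.1 ≠ p.2 → ε < ‖p.1 - p.2‖ₑ ^ 2 * μ univ := by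
      rw [eventually_all_finite (hZ.prod hZ)]
      intro p _
      by_cases hp : p.1 = p.2
      · simp [hp]
      · have : 0 < ‖p.1 - p.2‖ₑ ^ 2 * μ univ := by
          refine pos_iff_ne_zero.2 (mul_ne_zero (pow_ne_zero _ ?_) hμ)
          simpa [sub_eq_zero] using hp
        filter_upwards [mem_nhdsWithin_of_mem_nhds (Iio_mem_nhds this)] with ε hε _ using hε
    obtain ⟨ε, hε, hε0⟩ := (hev.and self_mem_nhdsWithin).exists
    refine ⟨ε / 4, (ENNReal.div_pos (ne_of_gt hε0) (by norm_num)).ne', fun t z hz z' hz' h h' => ?_⟩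
    by_contra hne
    have h1 := hε (z, z') ⟨hz, hz'⟩ hne
    refine absurd h1 (not_lt.2 ?_)
    have h2 := hv t
    calc ‖z - z'‖ₑ ^ 2 * μ univ = ∫⁻ x, ‖z - z'‖ₑ ^ 2 ∂μ := by rw [lintegral_const]
      _ ≤ ∫⁻ x, (2 * ‖v t x - z'‖ₑ ^ 2 + 2 * ‖v t x - z‖ₑ ^ 2) ∂μ := by
          refine lintegral_mono fun x => ?_
          have := enorm_sq_le (v t x - z') (-(v t x - z))
          rw [enorm_neg] at this
          simpa using this
      _ = 2 * q t z' + 2 * q t z := by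
          rw [lintegral_add_left (by fun_prop), lintegral_const_mul _ (by fun_prop),
            lintegral_const_mul _ (by fun_prop)]
      _ ≤ 2 * (ε / 4) + 2 * (ε / 4) := by gcongr
      _ = ε := by
          rw [← add_mul]; norm_num
          exact ENNReal.mul_div_cancel (by norm_num) (by norm_num)
  have facts : ∀ ε : ℝ≥0∞, ε ≠ 0 → ∃ T : ℝ, (∀ t ≥ T, ∃ z ∈ Z, q t z ≤ ε) ∧
      ∀ s t, T ≤ s → s ≤ t → t ≤ s + 1 → ∀ z, q t z ≤ 2 * q s z + ε := by
    intro ε hε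
    have hε4 : ε / 4 ≠ 0 := (ENNReal.div_pos hε (by norm_num)).ne'
    obtain ⟨δ, hδ, hδz⟩ := hcomp (ε / 4) hε4
    obtain ⟨T₁, hT₁⟩ := tail_small e he δ hδ
    obtain ⟨T₂, hT₂⟩ := tail_small D hD (ε / 4) hε4
    have hdd : ∀ s t, T₂ ≤ s → s ≤ t → t ≤ s + 1 → ∫⁻ x, ‖v t x - v s x‖ₑ ^ 2 ∂μ ≤ ε / 4 := by
      intro s t hs hst hts
      refine (hdist s t hst).trans ?_
      calc _ ≤ 1 * ∫⁻ r in Ici T₂, D r := by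
            gcongr
            · rw [← ENNReal.ofReal_one]; exact ENNReal.ofReal_le_ofReal (by linarith)
            · exact fun r hr => hs.trans hr.1
        _ ≤ ε / 4 := by rw [one_mul]; exact hT₂.le
    have h44 : 2 * (ε / 4) + 2 * (ε / 4) = ε := by
      rw [← add_mul]; norm_num
      exact ENNReal.mul_div_cancel (by norm_num) (by norm_num)
    refine ⟨max T₁ T₂, fun t ht => ?_, fun s t hs hst hts z => ?_⟩
    · obtain ⟨s, hs, hes⟩ : ∃ s ∈ Icc t (t + 1), e s ≤ δ := by
        by_contra! hcon
        have h1 : ∫⁻ s in Icc t (t + 1), δ ≤ ∫⁻ s in Icc t (t + 1), e s :=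
          setLIntegral_mono' measurableSet_Icc fun s hs => (hcon s hs).le
        have h2 : ∫⁻ s in Icc t (t + 1), e s ≤ ∫⁻ s in Ici T₁, e s :=
          lintegral_mono_set fun r hr => (le_max_left _ _).trans (ht.trans hr.1)
        have h3 : ∫⁻ s in Icc t (t + 1), δ = δ := by simp
        rw [h3] at h1
        exact absurd hT₁ (not_lt.2 (h1.trans h2))
      obtain ⟨z, hz, hqz⟩ := hδz s hes
      refine ⟨z, hz, (hquasi s t z).trans ?_⟩
      have h5 := hdd t s ((le_max_right _ _).trans ht) hs.1 hs.2
      have h6 : ∫⁻ x, ‖v t x - v s x‖ₑ ^ 2 ∂μ = ∫⁻ x, ‖v s x - v t x‖ₑ ^ 2 ∂μ := by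
        refine lintegral_congr fun x => ?_
        rw [← enorm_neg, neg_sub]
      rw [h6, ← h44]
      gcongr
    · refine (hquasi s t z).trans ?_
      rw [add_comm]
      gcongr
      refine (mul_le_mul_right (hdd s t ((le_max_right _ _).trans hs) hst hts) 2).trans ?_
      calc 2 * (ε / 4) ≤ 2 * (ε / 4) + 2 * (ε / 4) := le_self_add
        _ = ε := h44
  set ε₁ := ε₀ / 3 with hε₁
  have hε₁0 : ε₁ ≠ 0 := (ENNReal.div_pos hε₀ (by norm_num)).ne'
  have h3 : 2 * ε₁ + ε₁ = ε₀ := by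
    calc 2 * ε₁ + ε₁ = 3 * ε₁ := by ring
      _ = ε₀ := ENNReal.mul_div_cancel (by norm_num) (by norm_num)
  have h10 : ε₁ ≤ ε₀ := by rw [← h3]; exact le_add_self
  obtain ⟨T, hTa, hTb⟩ := facts ε₁ hε₁0
  obtain ⟨z, hz, hqz⟩ := hTa T le_rfl
  have hconst : ∀ n : ℕ, ∀ t, T ≤ t → t ≤ T + n → q t z ≤ ε₁ := by
    intro n
    induction n with
    | zero =>
      intro t h1 h2
      have : t = T := by simp at h2; linarith
      rwa [this]
    | succ n ih =>
      intro t h1 h2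
      push_cast at h2
      have hs := ih (max T (t - 1)) (le_max_left _ _)
        (max_le (by linarith [n.cast_nonneg (α := ℝ)]) (by linarith))
      have ht := hTb (max T (t - 1)) t (le_max_left _ _) (max_le h1 (by linarith))
        (by linarith [le_max_right T (t - 1)]) z
      have ht0 : q t z ≤ ε₀ := by
        refine ht.trans ?_
        rw [← h3]
        gcongr
      obtain ⟨z', hz', hq'⟩ := hTa t h1
      have := hsep t z hz z' hz' ht0 (hq'.trans h10)
      rwa [this]
  refine ⟨z, hz, ?_⟩
  rw [ENNReal.tendsto_nhds_zero]
  intro ε hε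
  obtain ⟨T', hT', -⟩ := facts (min ε ε₁) (lt_min hε (pos_iff_ne_zero.2 hε₁0)).ne'
  filter_upwards [eventually_ge_atTop T, eventually_ge_atTop T'] with t ht ht'
  obtain ⟨n, hn⟩ := exists_nat_ge (t - T)
  have h1 := hconst n t ht (by linarith)
  obtain ⟨z', hz', hq'⟩ := hT' t ht'
  have := hsep t z hz z' hz' (h1.trans h10) ((hq'.trans (min_le_right _ _)).trans h10)
  rw [this]
  exact hq'.trans (min_le_left _ _)

lemma meas_grad {m N : ℕ} (ω : Set (EuclideanSpace ℝ (Fin m))) (hω : IsOpen ω)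
    (u : ℝ × EuclideanSpace ℝ (Fin m) → EuclideanSpace ℝ (Fin N)) (hu : Measurable u)
    (hd : ∀ t, DifferentiableOn ℝ (fun y => u (t, y)) ω) :
    Measurable ((univ ×ˢ ω : Set (ℝ × EuclideanSpace ℝ (Fin m))).indicator
      fun p => fderivWithin ℝ (fun y => u (p.1, y)) ω p.2) := by
  have hS : MeasurableSet (univ ×ˢ ω : Set (ℝ × EuclideanSpace ℝ (Fin m))) :=
    MeasurableSet.univ.prod hω.measurableSet
  have hcoord : ∀ h : EuclideanSpace ℝ (Fin m), Measurable
      ((univ ×ˢ ω : Set (ℝ × EuclideanSpace ℝ (Fin m))).indicator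
      fun p => fderivWithin ℝ (fun y => u (p.1, y)) ω p.2 h) := by
    intro h
    refine measurable_of_tendsto_metrizable (f := fun n : ℕ =>
      (univ ×ˢ ω : Set (ℝ × EuclideanSpace ℝ (Fin m))).indicator
        fun p => (n : ℝ) • (u (p.1, p.2 + (n : ℝ)⁻¹ • h) - u p)) ?_ ?_
    · intro n
      refine Measurable.indicator ?_ hS
      have : Measurable fun p : ℝ × EuclideanSpace ℝ (Fin m) => u (p.1, p.2 + (n : ℝ)⁻¹ • h) :=
        hu.comp (by fun_prop)
      fun_prop
    · rw [tendsto_pi_nhds]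
      rintro ⟨t, y⟩
      by_cases hy : y ∈ ω
      · have hmem : (t, y) ∈ (univ ×ˢ ω : Set (ℝ × EuclideanSpace ℝ (Fin m))) := ⟨trivial, hy⟩
        simp only [indicator_of_mem hmem]
        rw [fderivWithin_of_isOpen hω hy]
        have hfd := ((hd t y hy).differentiableAt (hω.mem_nhds hy)).hasFDerivAt
        refine hfd.lim h (c := fun n : ℕ => (n : ℝ)) ?_
        simpa using tendsto_natCast_atTop_atTop (R := ℝ)
      · have hmem : (t, y) ∉ (univ ×ˢ ω : Set (ℝ × EuclideanSpace ℝ (Fin m))) := fun h => hy h.2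
        simp only [indicator_of_notMem hmem]
        exact tendsto_const_nhds
  have hrep : ∀ L : EuclideanSpace ℝ (Fin m) →L[ℝ] EuclideanSpace ℝ (Fin N),
      L = ∑ i, (EuclideanSpace.proj (𝕜 := ℝ) i).smulRight (L (EuclideanSpace.single i 1)) := by
    intro L
    ext1 x
    have hx : x = ∑ i, x i • EuclideanSpace.single i (1 : ℝ) := by
      ext j
      simp [Finset.sum_apply, Pi.single_apply]
    conv_lhs => rw [hx]
    simp [map_sum]
  have heq : ((univ ×ˢ ω : Set (ℝ × EuclideanSpace ℝ (Fin m))).indicator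
      fun p => fderivWithin ℝ (fun y => u (p.1, y)) ω p.2) = fun p =>
      ∑ i, (EuclideanSpace.proj (𝕜 := ℝ) i).smulRight
        ((univ ×ˢ ω : Set (ℝ × EuclideanSpace ℝ (Fin m))).indicator
      (fun p => fderivWithin ℝ (fun y => u (p.1, y)) ω p.2 (EuclideanSpace.single i 1)) p) := by
    funext p
    by_cases hp : p ∈ (univ ×ˢ ω : Set (ℝ × EuclideanSpace ℝ (Fin m)))
    · simp only [indicator_of_mem hp]
      exact hrep _
    · simp only [indicator_of_notMem hp]
      ext1 x
      simp
  rw [heq]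
  refine Finset.measurable_fun_sum _ fun i _ => ?_
  have hcont : Continuous fun w : EuclideanSpace ℝ (Fin N) =>
      (EuclideanSpace.proj (𝕜 := ℝ) i : EuclideanSpace ℝ (Fin m) →L[ℝ] ℝ).smulRight w :=
    (ContinuousLinearMap.smulRightL ℝ (EuclideanSpace ℝ (Fin m)) (EuclideanSpace ℝ (Fin N))
      (EuclideanSpace.proj (𝕜 := ℝ) i)).continuous
  exact hcont.measurable.comp (hcoord _)

/-- **Theorem 1, L² part.** For `ω ⊂ ℝ^{d-1}` open bounded connected with
Lipschitz boundary, `W : ℝ^N → [0,∞]` lower semicontinuous with (H1) and (H2), and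
`u ∈ H¹_loc(ℝ × ω, ℝ^N)` (encoded via the partial derivative `g = ∂₁u` in the FTC sense and
`H¹` slices) of finite energy `E(u) = ∫_{ℝ×ω} (|∇u|² + W(u)) < ∞`, there exist wells
`u⁻, u⁺` of `W` with `‖u(x₁,·) − u^±‖_{L²(ω)} → 0` as `x₁ → ±∞`. -/
theorem main_L2_convergence {m N : ℕ} (ω : Set (EuclideanSpace ℝ (Fin m)))
    (hωo : IsOpen ω) (hωc : IsConnected ω) (hωb : Bornology.IsBounded ω)
    (hωl : LipschitzBoundary ω)
    (W : EuclideanSpace ℝ (Fin N) → ℝ≥0∞) (hlsc : LowerSemicontinuous W)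
    (hH1 : {z : EuclideanSpace ℝ (Fin N) | W z = 0}.Finite)
    (hH2 : ∃ c : ℝ≥0∞, 0 < c ∧ ∃ R : ℝ, ∀ z : EuclideanSpace ℝ (Fin N), R ≤ ‖z‖ → c ≤ W z)
    (u g : ℝ × EuclideanSpace ℝ (Fin m) → EuclideanSpace ℝ (Fin N))
    (hu : Measurable u) (hg : Measurable g)
    (hFTC : ∀ x' ∈ ω, ∀ s t : ℝ, u (t, x') - u (s, x') = ∫ r in s..t, g (r, x'))
    (hslice : ∀ t : ℝ, MemH1 ω (fun y => u (t, y)))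
    (hE : (∫⁻ p in (Set.univ ×ˢ ω : Set (ℝ × EuclideanSpace ℝ (Fin m))),
        ((‖g p‖₊ : ℝ≥0∞) ^ 2 +
          (‖fderivWithin ℝ (fun y => u (p.1, y)) ω p.2‖₊ : ℝ≥0∞) ^ 2 + W (u p))) < ⊤) :
    ∃ um up : EuclideanSpace ℝ (Fin N), W um = 0 ∧ W up = 0 ∧
      Tendsto (fun t => ∫⁻ x' in ω, (‖u (t, x') - up‖₊ : ℝ≥0∞) ^ 2) atTop (nhds 0) ∧
      Tendsto (fun t => ∫⁻ x' in ω, (‖u (t, x') - um‖₊ : ℝ≥0∞) ^ 2) atBot (nhds 0) := by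
  simp only [← enorm_eq_nnnorm] at hE ⊢
  have hut : ∀ t, Measurable fun y => u (t, y) := fun t => hu.comp (by fun_prop)
  have hgt : ∀ t, Measurable fun y => g (t, y) := fun t => hg.comp (by fun_prop)
  have hgx : ∀ y, Measurable fun t => g (t, y) := fun y => hg.comp (by fun_prop)
  have hWm : Measurable W := hlsc.measurable
  set S : Set (ℝ × EuclideanSpace ℝ (Fin m)) := univ ×ˢ ω with hS
  have hSm : MeasurableSet S := MeasurableSet.univ.prod hωo.measurableSet
  have hgrad := meas_grad ω hωo u hu (fun t => (hslice t).1)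
  have hgradae : AEMeasurable (fun p : ℝ × EuclideanSpace ℝ (Fin m) =>
      ‖fderivWithin ℝ (fun y => u (p.1, y)) ω p.2‖ₑ ^ 2) (volume.restrict S) := by
    have h1 : AEMeasurable (fun p : ℝ × EuclideanSpace ℝ (Fin m) =>
        fderivWithin ℝ (fun y => u (p.1, y)) ω p.2) (volume.restrict S) :=
      (aemeasurable_indicator_iff hSm).1 hgrad.aemeasurable
    exact h1.enorm.pow_const 2
  set e : ℝ → ℝ≥0∞ := fun t => ∫⁻ x in ω, (‖fderivWithin ℝ (fun y => u (t, y)) ω x‖ₑ ^ 2 + W (u (t, x)))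
    with he
  set D : ℝ → ℝ≥0∞ := fun t => ∫⁻ x in ω, ‖g (t, x)‖ₑ ^ 2 with hD
  have heE : ∫⁻ t, e t ≠ ⊤ := by
    refine ne_of_lt (lt_of_le_of_lt ?_ hE)
    have h1 : AEMeasurable (fun p : ℝ × EuclideanSpace ℝ (Fin m) =>
      ‖fderivWithin ℝ (fun y => u (p.1, y)) ω p.2‖ₑ ^ 2 + W (u p)) (volume.restrict S) :=
      hgradae.add (hWm.comp hu).aemeasurable
    have h2 := setLIntegral_prod (μ := (volume : Measure ℝ))
      (ν := (volume : Measure (EuclideanSpace ℝ (Fin m)))) (s := univ) (t := ω) _ h1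
    rw [Measure.restrict_univ] at h2
    rw [he]
    refine (le_of_eq h2.symm).trans ?_
    refine lintegral_mono fun p => ?_
    rw [add_assoc]
    exact le_add_self
  have hDE : ∫⁻ t, D t ≠ ⊤ := by
    refine ne_of_lt (lt_of_le_of_lt ?_ hE)
    have h1 : AEMeasurable (fun p : ℝ × EuclideanSpace ℝ (Fin m) =>
      ‖g p‖ₑ ^ 2) (volume.restrict S) := by fun_prop
    have h2 := setLIntegral_prod (μ := (volume : Measure ℝ))
      (ν := (volume : Measure (EuclideanSpace ℝ (Fin m)))) (s := univ) (t := ω) _ h1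
    rw [Measure.restrict_univ] at h2
    rw [hD]
    refine (le_of_eq h2.symm).trans ?_
    refine lintegral_mono fun p => ?_
    rw [add_assoc]
    exact le_self_add
  have hdist : ∀ s t, s ≤ t → ∫⁻ x in ω, ‖u (t, x) - u (s, x)‖ₑ ^ 2 ≤
      ENNReal.ofReal (t - s) * ∫⁻ r in Icc s t, D r := by
    intro s t hst
    have hjm : Measurable fun p : EuclideanSpace ℝ (Fin m) × ℝ => ‖g (p.2, p.1)‖ₑ ^ 2 := by
      have : Measurable fun p : EuclideanSpace ℝ (Fin m) × ℝ => g (p.2, p.1) :=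
        hg.comp (by fun_prop)
      fun_prop
    calc _ ≤ ∫⁻ x in ω, ENNReal.ofReal (t - s) * ∫⁻ r in Icc s t, ‖g (r, x)‖ₑ ^ 2 := by
          refine setLIntegral_mono' hωo.measurableSet fun x hx => ?_
          have h1 : ‖u (t, x) - u (s, x)‖ₑ ≤ ∫⁻ r in Icc s t, ‖g (r, x)‖ₑ := by
            rw [hFTC x hx, intervalIntegral.integral_of_le hst, ← integral_Icc_eq_integral_Ioc]
            exact enorm_integral_le_lintegral_enorm _
          refine (pow_le_pow_left₀ zero_le h1 2).trans ?_
          refine (cs_one _ _ (hgx x).enorm.aemeasurable).trans (le_of_eq ?_)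
          rw [Measure.restrict_apply_univ, Real.volume_Icc]
      _ = ENNReal.ofReal (t - s) * ∫⁻ x in ω, ∫⁻ r in Icc s t, ‖g (r, x)‖ₑ ^ 2 :=
          lintegral_const_mul _ hjm.lintegral_prod_right'
      _ = _ := by
          rw [lintegral_lintegral_swap hjm.aemeasurable]
  have hcomp : ∀ ε : ℝ≥0∞, ε ≠ 0 → ∃ δ : ℝ≥0∞, δ ≠ 0 ∧ ∀ t, e t ≤ δ →
      ∃ z ∈ {z | W z = 0}, ∫⁻ x in ω, ‖u (t, x) - z‖ₑ ^ 2 ≤ ε := by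
    intro ε hε
    obtain ⟨δ, hδ, h⟩ := comp_wells hωo hωc hωb hωl W hlsc hH2 ε hε
    exact ⟨δ, hδ, fun t ht => h (fun y => u (t, y)) (hut t) (hslice t).1 ht⟩
  have hμ : volume.restrict ω univ ≠ 0 := by
    rw [Measure.restrict_apply_univ]
    exact (hωo.measure_pos volume hωc.nonempty).ne'
  obtain ⟨up, hup, htop⟩ := dyn (volume.restrict ω) hμ {z | W z = 0} hH1 (fun t y => u (t, y)) hut
    e D heE hDE hdist hcomp
  have hneg : ∀ f : ℝ → ℝ≥0∞, ∫⁻ t, f (-t) = ∫⁻ t, f t := fun f => lintegral_neg_eq_self f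
  obtain ⟨um, hum, hbot⟩ := dyn (volume.restrict ω) hμ {z | W z = 0} hH1 (fun t y => u (-t, y))
    (fun t => hut (-t)) (fun t => e (-t)) (fun t => D (-t)) (by rwa [hneg]) (by rwa [hneg])
    (by
      intro s t hst
      have h1 := hdist (-t) (-s) (by linarith)
      have h2 : ∫⁻ r in Icc (-t) (-s), D r = ∫⁻ r in Icc s t, D (-r) := by
        rw [← lintegral_indicator measurableSet_Icc, ← lintegral_indicator measurableSet_Icc,
          ← hneg]
        refine lintegral_congr fun r => ?_
        by_cases hr : r ∈ Icc s t
        · have : -r ∈ Icc (-t) (-s) := ⟨by linarith [hr.2], by linarith [hr.1]⟩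
          rw [indicator_of_mem hr, indicator_of_mem this]
        · have : -r ∉ Icc (-t) (-s) := fun h => hr ⟨by linarith [h.2], by linarith [h.1]⟩
          rw [indicator_of_notMem hr, indicator_of_notMem this]
      rw [h2] at h1
      have h3 : -s - -t = t - s := by ring
      rw [h3] at h1
      refine le_trans (le_of_eq ?_) h1
      refine lintegral_congr fun x => ?_
      rw [← enorm_neg, neg_sub])
    (by
      intro ε hε
      obtain ⟨δ, hδ, h⟩ := hcomp ε hε
      exact ⟨δ, hδ, fun t ht => h (-t) ht⟩)
  refine ⟨um, up, hum, hup, htop, ?_⟩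
  have := hbot.comp tendsto_neg_atBot_atTop
  simpa [Function.comp_def] using this
end
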